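/- arXiv:1805.07953 — 6 statements merged into one kernel-verified Lean document; each statement's English description precedes it below -/
import Mathlib

section
/- Let $\mathfrak{g}$ be a complex semisimple Lie algebra with Cartan subalgebra $\mathfrak{h}$ and root system $\Delta$. If $W$ is a linear subspace of $\mathfrak{h}^*$, then there exists a base (set of simple roots) $\Sigma$ of $\Delta$ such that every root in $\Delta \cap W$ is an integral linear combination of elements of $\Sigma \cap W$. -/
/-- `S` is a base of `Δ` (subset of a complex vector space): a linearly independent subset
such that every element of `Δ` is an integral combination of elements of `S` with all
coefficients nonnegative or all nonpositive. -/
def IsBaseC {V : Type*} [AddCommGroup V] [Module ℂ V] (Δ S : Set V) : Prop :=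
  S ⊆ Δ ∧ LinearIndependent ℂ ((↑) : S → V) ∧
    ∀ β ∈ Δ, ∃ c : V →₀ ℤ, ↑c.support ⊆ S ∧
      β = c.sum (fun v n => (n : ℤ) • v) ∧ ((∀ v, 0 ≤ c v) ∨ (∀ v, c v ≤ 0))

open Module in
/-- Finitely many vectors outside a subspace are separated from it by a rational functional. -/
lemma Submodule.exists_addMonoidHom_rat_forall_apply_ne_zero
    {ι R M : Type*} [Finite ι] [Field R] [CharZero R] [AddCommGroup M] [Module R M]
    (W : Submodule R M) (v : ι → M) :
    ∃ g : M →+ ℚ, (∀ w ∈ W, g w = 0) ∧ ∀ i, v i ∉ W → g (v i) ≠ 0 := by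
  let _ : Module ℚ (M ⧸ W) := Module.compHom (M ⧸ W) (algebraMap ℚ R)
  obtain ⟨g, hg⟩ := exists_dual_forall_apply_ne_zero (K := ℚ)
    (fun i : {i // v i ∉ W} ↦ W.mkQ (v i)) fun i ↦ by simpa using i.2
  refine ⟨(g : M ⧸ W →+ ℚ).comp W.mkQ.toAddMonoidHom, fun w hw ↦ ?_, fun i hi ↦ hg ⟨i, hi⟩⟩
  have : W.mkQ w = 0 := by simpa using hw
  simp [this]

/-- Given `g` and a regular `h`, some regular `f` is positive wherever `g` is. -/
lemma AddMonoidHom.exists_forall_apply_ne_zero_of_pos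
    {ι M : Type*} [Finite ι] [AddCommGroup M] (v : ι → M) (g h : M →+ ℚ)
    (hh : ∀ i, h (v i) ≠ 0) :
    ∃ f : M →+ ℚ, (∀ i, f (v i) ≠ 0) ∧ ∀ i, 0 < f (v i) → 0 ≤ g (v i) := by
  choose n hn using fun i ↦ exists_nat_gt (|h (v i)| / |g (v i)|)
  obtain ⟨N, hN⟩ := Set.finite_range n |>.bddAbove
  have key (i : ι) (hi : g (v i) ≠ 0) : |h (v i)| < N * |g (v i)| := by
    rw [← div_lt_iff₀ (abs_pos.mpr hi)]
    exact (hn i).trans_le (by exact_mod_cast hN ⟨i, rfl⟩)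
  refine ⟨N • g + h, fun i ↦ ?_, fun i hi ↦ ?_⟩
  · rcases eq_or_ne (g (v i)) 0 with h0 | h0
    · simpa [h0] using hh i
    · intro hz
      have hz : h (v i) = -(N * g (v i)) := by
        simp only [add_apply, nsmul_apply, nsmul_eq_mul] at hz
        linarith
      simpa [hz, abs_mul] using key i h0
  · by_contra! hneg
    have := key i hneg.ne
    rw [abs_of_neg hneg] at this
    simp only [add_apply, nsmul_apply, nsmul_eq_mul] at hi
    linarith [le_abs_self (h (v i))]

/-- If `g` is nonnegative on `s`, then the face `g = 0` of the cone spanned by `s` is spanned by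
the elements of `s` lying on it. -/
lemma AddSubmonoid.mem_closure_inter_of_apply_eq_zero
    {M : Type*} [AddCommMonoid M] (g : M →+ ℚ) (s : Set M) (hs : ∀ x ∈ s, 0 ≤ g x)
    {x : M} (hx : x ∈ closure s) (hgx : g x = 0) :
    x ∈ closure (s ∩ {y | g y = 0}) := by
  suffices 0 ≤ g x ∧ (g x = 0 → x ∈ closure (s ∩ {y | g y = 0})) from this.2 hgx
  clear hgx
  induction hx using closure_induction with
  | mem x hx => exact ⟨hs x hx, fun h ↦ subset_closure ⟨hx, h⟩⟩
  | zero => simp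
  | add x y _ _ hx hy =>
    refine ⟨by simpa using add_nonneg hx.1 hy.1, fun h ↦ ?_⟩
    rw [map_add] at h
    exact add_mem (hx.2 (by linarith [hx.1, hy.1])) (hy.2 (by linarith [hx.1, hy.1]))

open IsAddIndecomposable in
/-- Every subspace `W` admits a base of the root system whose elements in `W` generate, up to sign,
all roots in `W`. -/
lemma RootPairing.exists_base_adapted_to_submodule
    {ι R M N : Type*} [Finite ι] [Field R] [CharZero R] [AddCommGroup M] [AddCommGroup N]
    [Module R M] [Module R N] (P : RootPairing ι R M N) [P.IsRootSystem] [P.IsCrystallographic]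
    (W : Submodule R M) :
    ∃ s : Set ι, LinearIndepOn R P.root s ∧
      (∀ i, P.root i ∈ AddSubmonoid.closure (P.root '' s) ∨
        -P.root i ∈ AddSubmonoid.closure (P.root '' s)) ∧
      ∀ i, P.root i ∈ W → P.root i ∈ AddSubmonoid.closure (P.root '' s ∩ W) ∨
        -P.root i ∈ AddSubmonoid.closure (P.root '' s ∩ W) := by
  let _ := P.indexNeg
  obtain ⟨g, hgW, hg⟩ := W.exists_addMonoidHom_rat_forall_apply_ne_zero P.root
  obtain ⟨h, -, hh⟩ :=
    (⊥ : Submodule R M).exists_addMonoidHom_rat_forall_apply_ne_zero P.root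
  obtain ⟨f, hf, hfg⟩ := AddMonoidHom.exists_forall_apply_ne_zero_of_pos P.root g h
    fun i ↦ hh i (by simpa using P.ne_zero i)
  have hmem (i : ι) := mem_or_neg_mem_closure_baseOf P.root f i (hf i) (by simp)
  have hnonneg : ∀ x ∈ P.root '' baseOf P.root f, 0 ≤ g x := by
    rintro - ⟨i, hi, rfl⟩
    exact hfg i (baseOf_subset_pos P.root f hi)
  have hface : P.root '' baseOf P.root f ∩ {y | g y = 0} ⊆ P.root '' baseOf P.root f ∩ W := by
    rintro - ⟨⟨i, hi, rfl⟩, h0⟩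
    exact ⟨⟨i, hi, rfl⟩, by_contra fun hW ↦ hg i hW h0⟩
  refine ⟨baseOf P.root f, P.linearIndepOn_root_baseOf f hf, hmem, fun i hi ↦ ?_⟩
  refine (hmem i).imp (fun h ↦ ?_) fun h ↦ ?_
  · exact AddSubmonoid.closure_mono hface <|
      AddSubmonoid.mem_closure_inter_of_apply_eq_zero g _ hnonneg h (hgW _ hi)
  · exact AddSubmonoid.closure_mono hface <|
      AddSubmonoid.mem_closure_inter_of_apply_eq_zero g _ hnonneg h (hgW _ (neg_mem hi))

/-- Elements of the additive monoid generated by `s` are nonnegative integral combinations. -/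
lemma AddSubmonoid.exists_finsupp_int_of_mem_closure {V : Type*} [AddCommGroup V] {s : Set V}
    {x : V} (hx : x ∈ closure s) :
    ∃ c : V →₀ ℤ, ↑c.support ⊆ s ∧ x = c.sum (fun v n => (n : ℤ) • v) ∧ ∀ v, 0 ≤ c v := by
  classical
  induction hx using closure_induction with
  | mem x hx =>
    refine ⟨.single x 1, fun y hy ↦ ?_, by simp, fun v ↦ ?_⟩
    · obtain rfl : x = y :=
        (Finset.mem_singleton.mp (Finsupp.support_single_subset hy)).symm
      exact hx
    · rw [Finsupp.single_apply]
      split_ifs <;> simp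
  | zero => exact ⟨0, by simp⟩
  | add x y _ _ hx hy =>
    obtain ⟨c, hcs, rfl, hc⟩ := hx
    obtain ⟨d, hds, rfl, hd⟩ := hy
    refine ⟨c + d, fun z hz ↦ ?_, ?_, fun v ↦ add_nonneg (hc v) (hd v)⟩
    · rcases Finset.mem_union.mp (Finsupp.support_add hz) with h | h
      exacts [hcs h, hds h]
    · rw [Finsupp.sum_add_index' (by simp) (by simp [add_smul])]

/-- If `x` or `-x` lies in the additive monoid generated by `s`, then `x` is an integral
combination of elements of `s` with coefficients of constant sign. -/
lemma AddSubmonoid.exists_finsupp_int_of_mem_or_neg_mem_closure {V : Type*} [AddCommGroup V]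
    {s : Set V} {x : V} (hx : x ∈ closure s ∨ -x ∈ closure s) :
    ∃ c : V →₀ ℤ, ↑c.support ⊆ s ∧ x = c.sum (fun v n => (n : ℤ) • v) ∧
      ((∀ v, 0 ≤ c v) ∨ (∀ v, c v ≤ 0)) := by
  rcases hx with hx | hx
  · obtain ⟨c, hcs, hxc, hc⟩ := exists_finsupp_int_of_mem_closure hx
    exact ⟨c, hcs, hxc, .inl hc⟩
  · obtain ⟨c, hcs, hxc, hc⟩ := exists_finsupp_int_of_mem_closure hx
    refine ⟨-c, by simpa using hcs, ?_, .inr fun v ↦ by simpa using hc v⟩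
    rw [Finsupp.sum_neg_index (by simp)]
    simpa [Finsupp.sum, neg_eq_iff_eq_neg] using hxc

/-- The roots of `LieAlgebra.IsKilling.rootSystem` are the nonzero functionals with nonzero root
space. -/
lemma LieAlgebra.IsKilling.range_rootSystem_root {L : Type*} [LieRing L] [LieAlgebra ℂ L]
    [FiniteDimensional ℂ L] [LieAlgebra.IsKilling ℂ L] (H : LieSubalgebra ℂ L)
    [H.IsCartanSubalgebra] :
    Set.range (rootSystem H).root =
      {α : Module.Dual ℂ H | α ≠ 0 ∧ LieAlgebra.rootSpace H ⇑α ≠ ⊥} := by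
  ext α
  constructor
  · rintro ⟨⟨χ, hχ⟩, rfl⟩
    exact ⟨(rootSystem H).ne_zero ⟨χ, hχ⟩, χ.genWeightSpace_ne_bot⟩
  · rintro ⟨h0, hα⟩
    refine ⟨⟨⟨α, hα⟩, ?_⟩, ?_⟩
    · simp only [LieSubalgebra.root, Finset.mem_filter_univ]
      exact fun h ↦ h0 (DFunLike.coe_injective h)
    · ext x
      simp

/-- for a complex semisimple Lie algebra with Cartan subalgebra `H` and root
system `Δ ⊆ H*`, and any subspace `W` of `H*`, there is a base `Sg` of `Δ` such that every
root in `Δ ∩ W` is an integral combination of elements of `Sg ∩ W`. -/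
theorem stmt0 (L : Type*) [LieRing L] [LieAlgebra ℂ L] [FiniteDimensional ℂ L]
    [LieAlgebra.IsSemisimple ℂ L]
    (H : LieSubalgebra ℂ L) [H.IsCartanSubalgebra]
    (Δ : Set (Module.Dual ℂ H))
    (hΔ : Δ = {α : Module.Dual ℂ H | α ≠ 0 ∧ LieAlgebra.rootSpace H ⇑α ≠ ⊥})
    (W : Submodule ℂ (Module.Dual ℂ H)) :
    ∃ Sg : Set (Module.Dual ℂ H), IsBaseC Δ Sg ∧
      ∀ α ∈ Δ ∩ (W : Set (Module.Dual ℂ H)),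
        ∃ c : Module.Dual ℂ H →₀ ℤ, ↑c.support ⊆ Sg ∩ (W : Set (Module.Dual ℂ H)) ∧
          α = c.sum (fun v n => (n : ℤ) • v) := by
  have : LieAlgebra.IsKilling ℂ L := inferInstance
  let P := LieAlgebra.IsKilling.rootSystem H
  have hrange : Set.range P.root = Δ :=
    (LieAlgebra.IsKilling.range_rootSystem_root H).trans hΔ.symm
  obtain ⟨s, hli, hsp, hsW⟩ := P.exists_base_adapted_to_submodule W
  refine ⟨P.root '' s, ⟨hrange ▸ Set.image_subset_range _ _, hli.id_image, ?_⟩, ?_⟩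
  · rw [← hrange]
    rintro - ⟨i, rfl⟩
    exact AddSubmonoid.exists_finsupp_int_of_mem_or_neg_mem_closure (hsp i)
  · rw [← hrange]
    rintro - ⟨⟨i, rfl⟩, hi⟩
    obtain ⟨c, hcs, hc, -⟩ :=
      AddSubmonoid.exists_finsupp_int_of_mem_or_neg_mem_closure (hsW i hi)
    exact ⟨c, hcs, hc⟩
end

section
/- Let $\mathfrak{g}$ be a complex semisimple Lie algebra, $\mathfrak{t}$ a toral subalgebra with centralizer $\mathfrak{m} = \mathfrak{c}_{\mathfrak{g}}(\mathfrak{t})$, and suppose $\mathfrak{t} = \mathfrak{z}(\mathfrak{m})$. Let $\pi : \mathfrak{h}^* \to \mathfrak{t}^*$ be restriction, where $\mathfrak{h} \supset \mathfrak{t}$ is a Cartan subalgebra. Then $\ker \pi$ equals the span of $\Delta_{\mathfrak{m}}$, the set of roots $\alpha \in \Delta$ vanishing on $\mathfrak{t}$. -/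
open LieAlgebra LieModule in
/-- An element of a Cartan subalgebra killed by every weight that vanishes on `t ⊆ H` commutes with
the centralizer of `t`. -/
theorem LieAlgebra.IsKilling.lie_eq_zero_of_forall_weight_apply_eq_zero
    {K L : Type*} [Field K] [CharZero K] [LieRing L] [LieAlgebra K L] [FiniteDimensional K L]
    [IsKilling K L] {H : LieSubalgebra K L} [H.IsCartanSubalgebra] [IsTriangularizable K H L]
    {t : Set H} {h : H}
    (hh : ∀ χ : Weight K H L, (∀ s ∈ t, χ s = 0) → χ h = 0)
    {y : L} (hy : ∀ s ∈ t, ⁅s, y⁆ = 0) : ⁅h, y⁆ = 0 := by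
  have hmem : y ∈ ⨆ χ : Weight K H L, (rootSpace H χ).toSubmodule := by
    rw [← LieSubmodule.iSup_toSubmodule, iSup_genWeightSpace_eq_top']
    simp
  have hind := LieSubmodule.iSupIndep_toSubmodule.mpr (iSupIndep_genWeightSpace' K H L)
  obtain ⟨f, hf, rfl⟩ := (Submodule.mem_iSup_iff_exists_finsupp _ _).mp hmem
  have hlie (s : H) : ⁅s, f.sum fun _ x ↦ x⁆ = ∑ χ ∈ f.support, χ s • f χ := by
    rw [Finsupp.sum, lie_sum]
    exact Finset.sum_congr rfl fun χ _ ↦ lie_eq_smul_of_mem_rootSpace (hf χ) s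
  rw [hlie]
  refine Finset.sum_eq_zero fun χ hχ ↦ ?_
  rw [hh χ fun s hs ↦ ?_, zero_smul]
  have := (iSupIndep_iff_finsetSum_eq_zero_imp_eq_zero _).mp hind f.support (fun χ ↦ χ s • f χ)
    (fun χ _ ↦ Submodule.smul_mem _ _ (hf χ)) ((hlie s).symm.trans (hy s hs)) χ hχ
  exact (smul_eq_zero.mp this).resolve_right (Finsupp.mem_support_iff.mp hχ)

/-- for a complex semisimple Lie algebra `L` with Cartan subalgebra `H`,
a subalgebra `t ≤ H` whose centralizer `m` satisfies `t = z(m)`, the kernel of the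
restriction map `π : H* → t*` equals the span of the roots vanishing on `t`. -/
theorem stmt2 (L : Type*) [LieRing L] [LieAlgebra ℂ L] [FiniteDimensional ℂ L]
    [LieAlgebra.IsSemisimple ℂ L]
    (H : LieSubalgebra ℂ L) [H.IsCartanSubalgebra]
    (t : LieSubalgebra ℂ L) (ht : t ≤ H)
    -- `t` is the center of its own centralizer `m = c_L(t)`:
    (hz : (t : Set L) =
      {x : L | (∀ s ∈ t, ⁅s, x⁆ = 0) ∧ ∀ y : L, (∀ s ∈ t, ⁅s, y⁆ = 0) → ⁅x, y⁆ = 0}) :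
    LinearMap.ker ((LieSubalgebra.inclusion ht).toLinearMap.dualMap) =
      Submodule.span ℂ {α : Module.Dual ℂ H |
        (α ≠ 0 ∧ LieAlgebra.rootSpace H ⇑α ≠ ⊥) ∧ ∀ x : t, α ⟨x.1, ht x.2⟩ = 0} := by
  apply le_antisymm
  · intro f hf
    rw [← Subspace.dualCoannihilator_dualAnnihilator_eq (W := Submodule.span ℂ _),
      Submodule.mem_dualAnnihilator]
    intro h hh
    have hh' (χ : LieModule.Weight ℂ H L) (hχ : ∀ s ∈ {s : H | (s : L) ∈ t}, χ s = 0) :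
        χ h = 0 := by
      by_cases h0 : χ.toLinear = 0
      · exact LinearMap.congr_fun h0 h
      · exact (Submodule.mem_dualCoannihilator _).mp hh χ.toLinear <| Submodule.subset_span
          ⟨⟨h0, χ.genWeightSpace_ne_bot⟩, fun x ↦ hχ _ x.2⟩
    have hmem : (h : L) ∈ (t : Set L) := by
      rw [hz]
      refine ⟨fun s hs ↦ ?_, fun y hy ↦ ?_⟩
      · exact congrArg Subtype.val (trivial_lie_zero H H ⟨s, ht hs⟩ h)
      · exact LieAlgebra.IsKilling.lie_eq_zero_of_forall_weight_apply_eq_zero hh'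
          fun s hs ↦ hy s hs
    exact LinearMap.congr_fun (LinearMap.mem_ker.mp hf) ⟨h, hmem⟩
  · rw [Submodule.span_le]
    rintro α ⟨-, hα⟩
    exact LinearMap.mem_ker.mpr (LinearMap.ext hα)
end

section
/- Let $R$ be a Kostant root system (the nonzero projections of a root system $\Delta$ modulo the span of a subset $I$ of a base of $\Delta$). Then every base $S$ of $R$ arises as $\pi(\Sigma) \setminus \{0\}$ for some base $\Sigma$ of $\Delta$ containing a base of $\Delta \cap \langle I \rangle$; in particular $R$ admits a base. -/
variable {V : Type*} [AddCommGroup V] [Module ℝ V]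

def IsRootSystem (Δ : Set V) : Prop :=
  Δ.Finite ∧ (0 : V) ∉ Δ ∧ (∀ α ∈ Δ, -α ∈ Δ) ∧
    ∀ α ∈ Δ, ∃ f : V →ₗ[ℝ] ℝ, f α = 2 ∧ (∀ β ∈ Δ, ∃ n : ℤ, f β = (n : ℝ)) ∧
      ∀ β ∈ Δ, β - f β • α ∈ Δ

def IsBase {W : Type*} [AddCommGroup W] [Module ℝ W] (Δ S : Set W) : Prop :=
  S ⊆ Δ ∧ LinearIndependent ℝ ((↑) : S → W) ∧
    ∀ β ∈ Δ, ∃ c : W →₀ ℤ, ↑c.support ⊆ S ∧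
      β = c.sum (fun v n => (n : ℝ) • v) ∧ ((∀ v, 0 ≤ c v) ∨ (∀ v, c v ≤ 0))

open Module Set Submodule

theorem AddSubmonoid.mem_closure_iff_exists_finsupp_int {W : Type*} [AddCommGroup W] [Module ℝ W]
    {S : Set W} {x : W} :
    x ∈ AddSubmonoid.closure S ↔ ∃ c : W →₀ ℤ, ↑c.support ⊆ S ∧
      x = c.sum (fun v n => (n : ℝ) • v) ∧ ∀ v, 0 ≤ c v := by
  classical
  constructor
  · intro hx
    induction hx using AddSubmonoid.closure_induction with
    | mem y hy =>
      refine ⟨Finsupp.single y 1, ?_, by simp, fun v => ?_⟩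
      · exact (Finset.coe_subset.2 Finsupp.support_single_subset).trans (by simpa using hy)
      · by_cases h : y = v <;> simp [h]
    | zero => exact ⟨0, by simp, by simp, by simp⟩
    | add y z _ _ hy hz =>
      obtain ⟨c, hcS, rfl, hc⟩ := hy
      obtain ⟨d, hdS, rfl, hd⟩ := hz
      refine ⟨c + d, ?_, ?_, fun v => add_nonneg (hc v) (hd v)⟩
      · refine (Finset.coe_subset.2 Finsupp.support_add).trans ?_
        simpa using ⟨hcS, hdS⟩
      · rw [Finsupp.sum_add_index] <;> simp [add_smul]
  · rintro ⟨c, hcS, rfl, hc⟩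
    refine AddSubmonoid.sum_mem _ fun v hv => ?_
    obtain ⟨n, hn⟩ := Int.eq_ofNat_of_zero_le (hc v)
    simp only [hn, Int.cast_natCast, Nat.cast_smul_eq_nsmul]
    exact AddSubmonoid.nsmul_mem _ (AddSubmonoid.subset_closure (hcS hv)) n

theorem isBase_iff {W : Type*} [AddCommGroup W] [Module ℝ W] {Δ S : Set W} :
    IsBase Δ S ↔ S ⊆ Δ ∧ LinearIndepOn ℝ id S ∧
      ∀ β ∈ Δ, β ∈ AddSubmonoid.closure S ∨ -β ∈ AddSubmonoid.closure S := by
  have key (β : W) : (∃ c : W →₀ ℤ, ↑c.support ⊆ S ∧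
      β = c.sum (fun v n => (n : ℝ) • v) ∧ ((∀ v, 0 ≤ c v) ∨ (∀ v, c v ≤ 0))) ↔
      β ∈ AddSubmonoid.closure S ∨ -β ∈ AddSubmonoid.closure S := by
    simp only [AddSubmonoid.mem_closure_iff_exists_finsupp_int]
    constructor
    · rintro ⟨c, hc, rfl, h | h⟩
      · exact .inl ⟨c, hc, rfl, h⟩
      · refine .inr ⟨-c, by simpa using hc, ?_, by simpa using h⟩
        rw [Finsupp.sum_neg_index] <;> simp [Finsupp.sum]
    · rintro (⟨c, hc, h, h'⟩ | ⟨c, hc, h, h'⟩)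
      · exact ⟨c, hc, h, .inl h'⟩
      · refine ⟨-c, by simpa using hc, ?_, .inr (by simpa using h')⟩
        rw [Finsupp.sum_neg_index, ← neg_neg β, h] <;> simp [Finsupp.sum]
  simp only [IsBase, key]
  rfl

/-- A linear form that vanishes on no root is positive on some base. -/
theorem IsRootSystem.exists_isBase_forall_pos {Δ : Set V} (hΔ : IsRootSystem Δ)
    (h : V →ₗ[ℝ] ℝ) (hh : ∀ α ∈ Δ, h α ≠ 0) :
    ∃ Sg : Set V, IsBase Δ Sg ∧ ∀ σ ∈ Sg, 0 < h σ := by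
  obtain ⟨hfin, h0, hneg, hrefl⟩ := hΔ
  have : Finite Δ := hfin
  have : IsAddTorsionFree V := .of_isTorsionFree ℝ V
  choose f hf2 hfint hfrefl using fun α : Δ => hrefl α α.2
  let W := span ℝ Δ
  have : FiniteDimensional ℝ W := FiniteDimensional.span_of_finite ℝ hfin
  let r : Δ ↪ V := Function.Embedding.subtype _
  let root : Δ ↪ W := ⟨fun α => ⟨α, subset_span α.2⟩, fun a b hab => by
    simpa [Subtype.ext_iff] using hab⟩
  have hmaps (α : Δ) : MapsTo (preReflection (r α) (f α)) (range r) (range r) := by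
    rintro - ⟨β, rfl⟩
    exact ⟨⟨_, hfrefl α β β.2⟩, by simp [r, preReflection_apply]⟩
  have hrange : range r = Δ := by simp [r]
  have hfinj : Function.Injective f := by
    intro a b hab
    exact r.injective <| eq_of_mapsTo_reflection_of_mem (f := f a) (g := f b)
      (finite_range r) (hf2 a) (hf2 b)
      (by rw [← hab]; exact hf2 a) (by rw [hab]; exact hf2 b) (hmaps a) (hmaps b) (mem_range_self b)
  let coroot : Δ ↪ Dual ℝ W := ⟨fun α => (f α).comp W.subtype, by
    have := injOn_dualMap_subtype_span_range_range (r := r) (c := f) (finite_range r) hf2 hmaps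
    rw [hrange] at this
    exact fun a b hab => hfinj (this (mem_range_self a) (mem_range_self b) hab)⟩
  let P : RootPairing Δ ℝ W (Dual ℝ W) := RootPairing.mk'' (Dual.eval ℝ W) root coroot
    (fun α => hf2 α)
    (by
      rintro α - ⟨β, rfl⟩
      exact ⟨⟨_, hfrefl α β β.2⟩, by
        ext; simp only [preReflection_apply]; rfl⟩)
    (by
      have : range root = W.subtype ⁻¹' Δ := by
        ext x
        exact ⟨fun ⟨α, hα⟩ => hα ▸ α.2, fun hx => ⟨⟨x, hx⟩, rfl⟩⟩
      rw [this]; exact span_span_coe_preimage)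
  have : P.IsCrystallographic := ⟨fun α β => by
    obtain ⟨n, hn⟩ := hfint β α α.2
    exact ⟨n, hn.symm⟩⟩
  let g : Dual ℝ W := h.comp W.subtype
  have hg (α : Δ) : g (P.root α) ≠ 0 := hh α α.2
  have hli := P.linearIndepOn_root_baseOf' g hg
  let _ := P.indexNeg
  have hcl (α : Δ) := IsAddIndecomposable.mem_or_neg_mem_closure_baseOf P.root (g : W →+ ℝ) α (hg α)
    (by simp)
  set b := IsAddIndecomposable.baseOf P.root (g : W →+ ℝ)
  have himg : W.subtype '' (P.root '' b) = (↑) '' b := by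
    rw [image_image]; rfl
  refine ⟨(↑) '' b, isBase_iff.2 ⟨by simp, ?_, fun β hβ => ?_⟩, ?_⟩
  · refine LinearIndepOn.id_image (v := ((↑) : Δ → V)) ?_
    exact hli.map_injOn W.subtype W.injective_subtype.injOn
  · have key {x : W} (hx : x ∈ AddSubmonoid.closure (P.root '' b)) :
        (x : V) ∈ AddSubmonoid.closure ((↑) '' b : Set V) := by
      rw [← himg]
      have := AddSubmonoid.mem_map_of_mem (W.subtype : W →+ V) hx
      rwa [AddMonoidHom.map_mclosure] at this
    exact (hcl ⟨β, hβ⟩).imp key key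
  · rintro - ⟨σ, hσ, rfl⟩
    exact IsAddIndecomposable.baseOf_subset_pos _ _ hσ

theorem IsBase.subset_span {W : Type*} [AddCommGroup W] [Module ℝ W] {Δ S : Set W}
    (h : IsBase Δ S) : Δ ⊆ span ℝ S := by
  have hle : AddSubmonoid.closure S ≤ (span ℝ S).toAddSubmonoid :=
    AddSubmonoid.closure_le.2 Submodule.subset_span
  intro β hβ
  rcases (isBase_iff.1 h).2.2 β hβ with hβ | hβ
  · exact hle hβ
  · exact neg_mem_iff.1 (hle hβ)

theorem IsBase.eq_of_subset {W : Type*} [AddCommGroup W] [Module ℝ W] {Δ S T : Set W}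
    (hS : IsBase Δ S) (hT : IsBase Δ T) (hST : S ⊆ T) : S = T :=
  (eq_of_linearIndepOn_id_of_span_subtype hT.2.1 hST (hT.1.trans hS.subset_span)).symm

/-- A base projects to a base modulo the span of any of its subsets. -/
theorem IsBase.image_mkQ {Δ Sg B : Set V} (h : IsBase Δ Sg) (hB : B ⊆ Sg)
    {p : Submodule ℝ V} (hp : span ℝ B = p) :
    IsBase ((p.mkQ '' Δ) \ {0}) ((p.mkQ '' Sg) \ {0}) := by
  obtain ⟨hsub, hli, hcl⟩ := isBase_iff.1 h
  refine isBase_iff.2 ⟨sdiff_subset_sdiff_left (image_mono hsub), ?_, ?_⟩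
  · have hdisj : Disjoint (span ℝ (Sg \ B)) (LinearMap.ker p.mkQ) := by
      have := hli.disjoint_span_image (s := (↑) ⁻¹' (Sg \ B)) (t := (↑) ⁻¹' B)
        (disjoint_sdiff_left.preimage _)
      simpa [image_image, hp, inter_eq_self_of_subset_right, hB] using this
    have hli' : LinearIndepOn ℝ p.mkQ (Sg \ B) :=
      (hli.mono sdiff_subset).map (f := p.mkQ) (by rwa [← image_eq_range, image_id])
    refine hli'.id_image.mono ?_
    rintro - ⟨⟨σ, hσ, rfl⟩, h0⟩
    refine ⟨σ, ⟨hσ, fun hσB => h0 ?_⟩, rfl⟩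
    simpa [← hp] using Submodule.subset_span (R := ℝ) hσB
  · rintro - ⟨⟨β, hβ, rfl⟩, -⟩
    have key {x : V} (hx : x ∈ AddSubmonoid.closure Sg) :
        p.mkQ x ∈ AddSubmonoid.closure ((p.mkQ '' Sg) \ {0}) := by
      rw [AddSubmonoid.closure_sdiff_singleton_zero]
      have := AddSubmonoid.mem_map_of_mem (p.mkQ : V →+ V ⧸ p) hx
      rwa [AddMonoidHom.map_mclosure] at this
    exact (hcl β hβ).imp key fun h => by simpa using key h

/-- The height with respect to a base, extended to a linear form. -/
theorem IsBase.exists_height {W : Type*} [AddCommGroup W] [Module ℝ W] {Δ S : Set W}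
    (h : IsBase Δ S) : ∃ φ : W →ₗ[ℝ] ℝ, (∀ s ∈ S, φ s = 1) ∧
      ∀ x ∈ AddSubmonoid.closure S, ∃ n : ℕ, φ x = n ∧ (n = 0 → x = 0) := by
  obtain ⟨φ, hφ⟩ := Module.exists_dual_forall_apply_eq_one (v := id) h.2.1
  refine ⟨φ, hφ, fun x hx => ?_⟩
  induction hx using AddSubmonoid.closure_induction with
  | mem y hy => exact ⟨1, by simpa using hφ y hy, by simp⟩
  | zero => exact ⟨0, by simp, by simp⟩
  | add y z _ _ hy hz =>
    obtain ⟨n, hn, hn0⟩ := hy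
    obtain ⟨m, hm, hm0⟩ := hz
    refine ⟨n + m, by simp [hn, hm], fun hnm => ?_⟩
    rw [hn0 (by lia), hm0 (by lia), add_zero]

theorem IsBase.height_ne_zero {W : Type*} [AddCommGroup W] [Module ℝ W] {Δ S : Set W}
    (h : IsBase Δ S) {φ : W →ₗ[ℝ] ℝ}
    (hφ : ∀ x ∈ AddSubmonoid.closure S, ∃ n : ℕ, φ x = n ∧ (n = 0 → x = 0))
    {β : W} (hβ : β ∈ Δ) (hβ0 : β ≠ 0) : φ β ≠ 0 := by
  intro h0
  rcases (isBase_iff.1 h).2.2 β hβ with hcl | hcl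
  · obtain ⟨n, hn, hn0⟩ := hφ _ hcl
    exact hβ0 (hn0 (by exact_mod_cast hn.symm.trans h0))
  · obtain ⟨n, hn, hn0⟩ := hφ _ hcl
    refine hβ0 (neg_eq_zero.1 (hn0 ?_))
    rw [map_neg, h0, neg_zero] at hn
    exact_mod_cast hn.symm

theorem IsBase.mem_closure_of_pos {Δ Sg : Set V} (hSg : IsBase Δ Sg) {h : V →ₗ[ℝ] ℝ}
    (hpos : ∀ σ ∈ Sg, 0 < h σ) {β : V} (hβ : β ∈ Δ) (hβpos : 0 < h β) :
    β ∈ AddSubmonoid.closure Sg := by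
  refine ((isBase_iff.1 hSg).2.2 β hβ).resolve_right fun hcl => ?_
  have : 0 ≤ h (-β) := by
    refine AddSubmonoid.closure_induction (motive := fun x _ => 0 ≤ h x)
      (fun x hx => (hpos x hx).le) (by simp) (fun x y _ _ hx hy => ?_) hcl
    rw [map_add]; exact add_nonneg hx hy
  rw [map_neg] at this
  linarith

/-- Given a set `Sg` and a linear form `g` taking natural values on `Sg`, elements of the cone of
`Sg` on which `g` vanishes lie in the cone of `{σ ∈ Sg | g σ = 0}`, and an element on which `g` is
`1` agrees with an element of `Sg` up to that cone. -/
theorem exists_natCast_eq_of_mem_closure {Sg : Set V} {g : V →ₗ[ℝ] ℝ}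
    (hg : ∀ σ ∈ Sg, ∃ n : ℕ, g σ = n) {x : V} (hx : x ∈ AddSubmonoid.closure Sg) :
    ∃ n : ℕ, g x = n ∧ (n = 0 → x ∈ AddSubmonoid.closure {σ ∈ Sg | g σ = 0}) ∧
      (n = 1 → ∃ σ ∈ Sg, ∃ y ∈ AddSubmonoid.closure {σ ∈ Sg | g σ = 0}, x = σ + y) := by
  induction hx using AddSubmonoid.closure_induction with
  | mem y hy =>
    obtain ⟨n, hn⟩ := hg y hy
    exact ⟨n, hn, fun h => AddSubmonoid.subset_closure ⟨hy, by simp [hn, h]⟩,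
      fun _ => ⟨y, hy, 0, zero_mem _, by simp⟩⟩
  | zero => exact ⟨0, by simp, fun _ => zero_mem _, by simp⟩
  | add y z _ _ hy hz =>
    obtain ⟨n, hn, hn0, hn1⟩ := hy
    obtain ⟨m, hm, hm0, hm1⟩ := hz
    refine ⟨n + m, by simp [hn, hm], fun h => add_mem (hn0 (by lia)) (hm0 (by lia)), fun h => ?_⟩
    obtain ⟨h1, h2⟩ | ⟨h1, h2⟩ : (n = 1 ∧ m = 0) ∨ (n = 0 ∧ m = 1) := by lia
    · obtain ⟨σ, hσ, u, hu, rfl⟩ := hn1 h1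
      exact ⟨σ, hσ, u + z, add_mem hu (hm0 h2), by abel⟩
    · obtain ⟨σ, hσ, u, hu, rfl⟩ := hm1 h2
      exact ⟨σ, hσ, y + u, add_mem (hn0 h1) hu, by abel⟩

/-- every base `S` of the Kostant root system `R = π(Δ) \ {0}` is of the form
`π(Sg) \ {0}` for a base `Sg` of `Δ` containing a base of `Δ ∩ ⟨I⟩`; in particular `R`
admits a base. -/
theorem stmt4 (Δ I : Set V) (hΔ : IsRootSystem Δ)
    (hI : ∃ Sg₀, IsBase Δ Sg₀ ∧ I ⊆ Sg₀) :
    (∀ S : Set (V ⧸ Submodule.span ℝ I),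
      IsBase (((Submodule.span ℝ I).mkQ '' Δ) \ {0}) S →
        ∃ Sg : Set V, IsBase Δ Sg ∧
          (∃ B ⊆ Sg, IsBase (Δ ∩ (Submodule.span ℝ I : Set V)) B) ∧
          S = ((Submodule.span ℝ I).mkQ '' Sg) \ {0}) ∧
    ∃ S : Set (V ⧸ Submodule.span ℝ I),
      IsBase (((Submodule.span ℝ I).mkQ '' Δ) \ {0}) S := by
  obtain ⟨Sg₀, hSg₀, hISg₀⟩ := hI
  refine ⟨fun S hS => ?_, _, hSg₀.image_mkQ hISg₀ rfl⟩
  set p := span ℝ I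
  have h0 : (0 : V) ∉ Δ := hΔ.2.1
  obtain ⟨φ, hφS, hφ⟩ := hS.exists_height
  obtain ⟨ψ, -, hψ⟩ := hSg₀.exists_height
  obtain ⟨N, hN⟩ : ∃ N : ℝ, ∀ α ∈ Δ, |ψ α| < N := by
    obtain ⟨M, hM⟩ := (hΔ.1.image fun α => |ψ α|).bddAbove
    exact ⟨M + 1, fun α hα => (hM (mem_image_of_mem _ hα)).trans_lt (lt_add_one M)⟩
  let g : V →ₗ[ℝ] ℝ := φ ∘ₗ p.mkQ
  let h : V →ₗ[ℝ] ℝ := N • g + ψ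
  have hgp {x : V} (hx : x ∈ p) : g x = 0 := by
    simp [g, (Submodule.Quotient.mk_eq_zero p).2 hx]
  have hmemR {α : V} (hα : α ∈ Δ) (hαp : α ∉ p) : p.mkQ α ∈ (p.mkQ '' Δ) \ {0} :=
    ⟨mem_image_of_mem _ hα, by simpa using hαp⟩
  have hg0 {α : V} (hα : α ∈ Δ) (hgα : g α = 0) : α ∈ p := by
    by_contra hαp
    exact hS.height_ne_zero hφ (hmemR hα hαp) (hmemR hα hαp).2 hgα
  have hpos {α : V} (hα : α ∈ Δ) (hgα : 1 ≤ g α) : 0 < h α := by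
    have := abs_lt.1 (hN α hα)
    simp only [h, LinearMap.add_apply, LinearMap.smul_apply, smul_eq_mul]
    nlinarith
  -- Roots outside `p` have the same sign for `g` and for `h`, and `g` is integral on them.
  have hgnat {α : V} (hα : α ∈ Δ) (hαp : α ∉ p) :
      (∃ n : ℕ, 1 ≤ n ∧ g α = n) ∨ ∃ n : ℕ, 1 ≤ n ∧ g (-α) = n := by
    refine ((isBase_iff.1 hS).2.2 _ (hmemR hα hαp)).imp ?_ ?_ <;> intro hcl <;>
    · obtain ⟨n, hn, hn0⟩ := hφ _ hcl
      refine ⟨n, Nat.one_le_iff_ne_zero.2 fun h => hαp ?_, by simpa [g] using hn⟩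
      simpa using hn0 h
  have hh : ∀ α ∈ Δ, h α ≠ 0 := by
    intro α hα
    by_cases hαp : α ∈ p
    · simpa [h, hgp hαp] using hSg₀.height_ne_zero hψ hα (ne_of_mem_of_not_mem hα h0)
    · rcases hgnat hα hαp with ⟨n, hn, hgα⟩ | ⟨n, hn, hgα⟩
      · exact (hpos hα (by rw [hgα]; exact_mod_cast hn)).ne'
      · have := hpos (hΔ.2.2.1 α hα) (by rw [hgα]; exact_mod_cast hn)
        rw [map_neg] at this
        exact (neg_pos.1 this).ne
  obtain ⟨Sg, hSg, hSgpos⟩ := hΔ.exists_isBase_forall_pos h hh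
  have hSgnat : ∀ σ ∈ Sg, ∃ n : ℕ, g σ = n := by
    intro σ hσ
    have hσΔ := hSg.1 hσ
    by_cases hσp : σ ∈ p
    · exact ⟨0, by simp [hgp hσp]⟩
    · rcases hgnat hσΔ hσp with ⟨n, -, hgσ⟩ | ⟨n, hn, hgσ⟩
      · exact ⟨n, hgσ⟩
      · have := hpos (hΔ.2.2.1 σ hσΔ) (by rw [hgσ]; exact_mod_cast hn)
        rw [map_neg] at this
        exact absurd (hSgpos σ hσ) (neg_pos.1 this).not_gt
  set B := {σ ∈ Sg | g σ = 0}
  have hBSg : B ⊆ Sg := sep_subset _ _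
  have hBp : B ⊆ p := fun σ hσ => hg0 (hSg.1 hσ.1) hσ.2
  have hclB {x : V} (hx : x ∈ AddSubmonoid.closure Sg) (hxp : x ∈ p) :
      x ∈ AddSubmonoid.closure B := by
    obtain ⟨n, hn, hn0, -⟩ := exists_natCast_eq_of_mem_closure hSgnat hx
    exact hn0 (by exact_mod_cast hn.symm.trans (hgp hxp))
  have hB : IsBase (Δ ∩ (p : Set V)) B := by
    obtain ⟨hsub, hli, hcl⟩ := isBase_iff.1 hSg
    refine isBase_iff.2 ⟨subset_inter (hBSg.trans hsub) hBp, hli.mono hBSg, fun β hβ => ?_⟩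
    exact (hcl β hβ.1).imp (hclB · hβ.2) (hclB · (neg_mem hβ.2))
  have hBspan : span ℝ B = p := le_antisymm (span_le.2 hBp) <| span_le.2 fun α hα =>
    hB.subset_span ⟨hSg₀.1 (hISg₀ hα), Submodule.subset_span hα⟩
  refine ⟨Sg, hSg, ⟨B, hBSg, hB⟩, hS.eq_of_subset (hSg.image_mkQ hBSg hBspan) fun s hs => ?_⟩
  obtain ⟨⟨α, hα, rfl⟩, hs0⟩ := hS.1 hs
  have hgα : g α = 1 := hφS _ hs
  obtain ⟨n, hn, -, hn1⟩ := exists_natCast_eq_of_mem_closure hSgnat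
    (hSg.mem_closure_of_pos hSgpos hα (hpos hα hgα.ge))
  obtain ⟨σ, hσ, y, hy, rfl⟩ := hn1 (by exact_mod_cast hn.symm.trans hgα)
  have hyp : y ∈ p := (AddSubmonoid.closure_le (S := p.toAddSubmonoid)).2 hBp hy
  refine ⟨⟨σ, hσ, ?_⟩, hs0⟩
  simp [(Submodule.Quotient.mk_eq_zero p).2 hyp]
end

section
/- Let $R$ be a Kostant root system and let $R^+$ be a positive system in $R$. Then the set of indecomposable elements of $R^+$ is a base of $R$. -/
variable {V : Type*} [AddCommGroup V] [Module ℝ V]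

/-- `P` is a positive system in `R`. -/
def IsPosSystem {W : Type*} [AddCommGroup W] [Module ℝ W] (R P : Set W) : Prop :=
  R = P ∪ (-P) ∧ P ∩ (-P) = ∅ ∧
    ∀ x ∈ P, ∀ y ∈ P, x + y ∈ R → x + y ∈ P

/-- The indecomposable elements of `P`. -/
def indec {W : Type*} [AddCommGroup W] (P : Set W) : Set W :=
  {ν ∈ P | ¬ ∃ a ∈ P, ∃ b ∈ P, ν = a + b}

open Module Submodule

theorem IsRootSystem.exists_form {Δ : Set V} (hΔ : IsRootSystem Δ) :
    ∃ B : LinearMap.BilinForm ℝ V, (∀ x ∈ span ℝ Δ, x ≠ 0 → 0 < B x x) ∧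
      ∀ α ∈ Δ, ∀ β ∈ Δ, B α β < 0 → α + β ≠ 0 → α + β ∈ Δ := by
  obtain ⟨hfin, -, -, hrefl⟩ := hΔ
  choose! f hf2 hfint hfrefl using hrefl
  have : Finite Δ := hfin
  have : Fintype Δ := Fintype.ofFinite Δ
  have : FiniteDimensional ℝ (span ℝ Δ) := FiniteDimensional.span_of_finite ℝ hfin
  let root : Δ ↪ span ℝ Δ := ⟨fun i => ⟨i, subset_span i.2⟩, fun i j h => by
    simpa [Subtype.ext_iff] using h⟩
  let c : Δ → Dual ℝ (span ℝ Δ) := fun i => (f i).comp (span ℝ Δ).subtype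
  have hmaps (i : Δ) : Set.MapsTo (preReflection (root i) (c i)) (Set.range root)
      (Set.range root) := by
    rintro - ⟨j, rfl⟩
    refine ⟨⟨_, hfrefl i i.2 j j.2⟩, ?_⟩
    exact Subtype.ext rfl
  have : IsAddTorsionFree (span ℝ Δ) := .of_isTorsionFree ℝ _
  let coroot : Δ ↪ Dual ℝ (span ℝ Δ) := ⟨c, fun i j h => root.injective <|
    eq_of_mapsTo_reflection_of_mem (f := c i) (g := c j) (Set.finite_range root)
      (hf2 i i.2) (hf2 j j.2) (by rw [← h]; exact hf2 i i.2) (by rw [h]; exact hf2 j j.2)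
      (hmaps i) (hmaps j) ⟨j, rfl⟩⟩
  have hsp : span ℝ (Set.range root) = ⊤ := by
    have : Set.range root = ((↑) : span ℝ Δ → V) ⁻¹' Δ := by
      ext x
      exact ⟨fun ⟨i, hi⟩ => hi ▸ i.2, fun hx => ⟨⟨x, hx⟩, rfl⟩⟩
    rw [this, span_span_coe_preimage]
  let P : RootPairing Δ ℝ (span ℝ Δ) (Dual ℝ (span ℝ Δ)) :=
    RootPairing.mk'' (Dual.eval ℝ (span ℝ Δ)) root coroot (fun i => hf2 i i.2) hmaps hsp
  have : P.IsCrystallographic := ⟨fun i j => by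
    obtain ⟨n, hn⟩ := hfint j j.2 i i.2
    exact ⟨n, hn.symm⟩⟩
  obtain ⟨p, hp⟩ := (span ℝ Δ).subtype.exists_leftInverse_of_injective (ker_subtype _)
  have hp' (x : V) (hx : x ∈ span ℝ Δ) : p x = ⟨x, hx⟩ := LinearMap.congr_fun hp ⟨x, hx⟩
  refine ⟨P.RootForm.compl₁₂ p p, fun x hx hx0 => ?_, fun α hα β hβ h h0 => ?_⟩
  · rw [LinearMap.compl₁₂_apply, hp' x hx]
    refine P.rootForm_pos_of_ne_zero ?_ (by simpa [Subtype.ext_iff] using hx0)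
    change _ ∈ span ℝ (Set.range root)
    rw [hsp]; trivial
  · rw [LinearMap.compl₁₂_apply, hp' α (subset_span hα), hp' β (subset_span hβ)] at h
    have h2 := P.toInvariantForm.two_mul_apply_root_root ⟨α, hα⟩ ⟨β, hβ⟩
    have hpos : 0 < P.RootForm (root ⟨β, hβ⟩) (root ⟨β, hβ⟩) :=
      P.rootForm_pos_of_ne_zero (subset_span ⟨_, rfl⟩) (P.ne_zero ⟨β, hβ⟩)
    have hneg : P.pairing ⟨α, hα⟩ ⟨β, hβ⟩ < 0 := by
      change 2 * P.RootForm (root ⟨α, hα⟩) (root ⟨β, hβ⟩) =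
        _ * P.RootForm (root ⟨β, hβ⟩) (root ⟨β, hβ⟩) at h2
      change P.RootForm (root ⟨α, hα⟩) (root ⟨β, hβ⟩) < 0 at h
      by_contra! hc
      nlinarith [mul_nonneg hc hpos.le]
    rw [← P.algebraMap_pairingIn ℤ] at hneg
    obtain ⟨k, hk⟩ := P.root_add_root_mem_of_pairingIn_neg (i := ⟨α, hα⟩) (j := ⟨β, hβ⟩)
      (by simpa using hneg) (fun h => h0 <| by
        have := congrArg Subtype.val (add_eq_zero_iff_eq_neg.mpr h)
        exact this)
    have : (k : V) = α + β := congrArg Subtype.val hk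
    exact this ▸ k.2

theorem IsPosSystem.add_ne_zero {R Q : Set V} (hQ : IsPosSystem R Q) {a b : V}
    (ha : a ∈ Q) (hb : b ∈ Q) : a + b ≠ 0 := fun h => by
  have : a ∈ Q ∩ -Q := ⟨ha, by rwa [Set.mem_neg, neg_eq_of_add_eq_zero_right h]⟩
  simp [hQ.2.1] at this

theorem IsPosSystem.multiset_sum_ne_zero {Δ Q : Set V} (hΔ : IsRootSystem Δ)
    (hQ : IsPosSystem Δ Q) (m : Multiset V) (hm : ∀ x ∈ m, x ∈ Q) (hm0 : m ≠ 0) :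
    m.sum ≠ 0 := by
  obtain ⟨B, hpos, hadd⟩ := hΔ.exists_form
  have hQΔ : Q ⊆ Δ := hQ.1 ▸ Set.subset_union_left
  induction hn : m.card using Nat.strong_induction_on generalizing m with
  | _ n ih =>
    intro hs
    obtain ⟨a, ha⟩ := Multiset.exists_mem_of_ne_zero hm0
    obtain ⟨t, rfl⟩ := Multiset.exists_cons_of_mem ha
    have haΔ := hQΔ (hm a ha)
    have ha0 : a ≠ 0 := fun h => hΔ.2.1 (h ▸ haΔ)
    have hB : B a t.sum < 0 := by
      rw [Multiset.sum_cons] at hs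
      rw [← neg_eq_of_add_eq_zero_right hs, map_neg]
      linarith [hpos a (subset_span haΔ) ha0]
    obtain ⟨b, hb, hab⟩ : ∃ b ∈ t, B a b < 0 := by
      by_contra! hc
      rw [map_multiset_sum] at hB
      exact hB.not_ge (Multiset.sum_nonneg (by simpa using hc))
    obtain ⟨u, rfl⟩ := Multiset.exists_cons_of_mem hb
    have hbQ : b ∈ Q := hm b (by simp)
    have hab0 : a + b ≠ 0 := hQ.add_ne_zero (hm a ha) hbQ
    have habQ := hQ.2.2 a (hm a ha) b hbQ (hadd a haΔ b (hQΔ hbQ) hab hab0)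
    refine ih (u.card + 1) (by simp at hn; omega) ((a + b) ::ₘ u) (fun x hx => ?_) (by simp)
      (by simp) (by simpa [add_assoc] using hs)
    rcases Multiset.mem_cons.mp hx with rfl | hx
    · exact habQ
    · exact hm x (by simp [hx])

/-- Induction along decompositions in a finite set having no nontrivial vanishing sums. -/
theorem decomposition_induction {A : Type*} [AddCommGroup A] {T : Set A} (hT : T.Finite)
    (h0 : ∀ m : Multiset A, (∀ x ∈ m, x ∈ T) → m ≠ 0 → m.sum ≠ 0) {p : A → Prop}
    (step : ∀ x ∈ T, (∀ a ∈ T, ∀ b ∈ T, x = a + b → p a ∧ p b) → p x) :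
    ∀ x ∈ T, p x := by
  have : Finite T := hT
  let r : T → T → Prop := fun a x =>
    ∃ m : Multiset A, (∀ y ∈ m, y ∈ T) ∧ m ≠ 0 ∧ (x : A) = a + m.sum
  have : IsTrans T r := ⟨by
    rintro a b c ⟨m, hm, hm0, h⟩ ⟨n, hn, -, h'⟩
    refine ⟨m + n, fun y hy => ?_, by simp [hm0], by rw [h', h, Multiset.sum_add, add_assoc]⟩
    exact (Multiset.mem_add.mp hy).elim (hm y) (hn y)⟩
  have : Std.Irrefl r := ⟨by
    rintro a ⟨m, hm, hm0, h⟩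
    exact h0 m hm hm0 (by simpa using h)⟩
  have hwf : WellFounded r := Finite.wellFounded_of_trans_of_irrefl r
  intro x hx
  refine hwf.induction (C := fun x : T => p x) ⟨x, hx⟩ fun x ih => step x x.2 ?_
  intro a ha b hb hab
  exact ⟨ih ⟨a, ha⟩ ⟨{b}, by simpa using hb, by simp, by simpa using hab⟩,
    ih ⟨b, hb⟩ ⟨{a}, by simpa using ha, by simp, by simpa [add_comm b] using hab⟩⟩

theorem subset_closure_indec {A : Type*} [AddCommGroup A] {T : Set A} (hT : T.Finite)
    (h0 : ∀ m : Multiset A, (∀ x ∈ m, x ∈ T) → m ≠ 0 → m.sum ≠ 0) :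
    ∀ x ∈ T, x ∈ AddSubmonoid.closure (indec T) := by
  refine decomposition_induction hT h0 fun x hx ih => ?_
  by_cases h : ∃ a ∈ T, ∃ b ∈ T, x = a + b
  · obtain ⟨a, ha, b, hb, hab⟩ := h
    rw [hab]
    exact add_mem (ih a ha b hb hab).1 (ih a ha b hb hab).2
  · exact AddSubmonoid.subset_closure ⟨hx, h⟩

theorem linearIndependent_int_of_obtuse {S : Set V} (B : LinearMap.BilinForm ℝ V)
    (hpos : ∀ x ∈ span ℝ S, x ≠ 0 → 0 < B x x)
    (hobt : ∀ x ∈ S, ∀ y ∈ S, x ≠ y → B x y ≤ 0)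
    (h0 : ∀ m : Multiset V, (∀ x ∈ m, x ∈ S) → m ≠ 0 → m.sum ≠ 0) :
    LinearIndependent ℤ ((↑) : S → V) := by
  classical
  have hzero (t : Finset S) (n : S → ℕ) (h : ∑ i ∈ t, n i • (i : V) = 0) :
      ∀ i ∈ t, n i = 0 := by
    have hs : (∑ i ∈ t, Multiset.replicate (n i) (i : V)) = 0 := by
      by_contra hne
      refine h0 _ (fun x hx => ?_) hne ?_
      · obtain ⟨i, -, hi⟩ := Multiset.mem_sum.mp hx
        rw [Multiset.eq_of_mem_replicate hi]
        exact i.2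
      · simpa [Multiset.sum_sum] using h
    intro i hi
    have := Finset.sum_eq_zero_iff.mp hs i hi
    simpa using congrArg Multiset.card this
  rw [linearIndependent_iff']
  intro s g hg
  set x := ∑ i ∈ s with 0 < g i, (g i).toNat • (i : V) with hx
  set y := ∑ i ∈ s with ¬ 0 < g i, (-g i).toNat • (i : V) with hy
  have hxy : x = y := by
    rw [← Finset.sum_filter_add_sum_filter_not s (fun i => 0 < g i)] at hg
    rw [← sub_eq_zero, ← hg, hx, hy, sub_eq_add_neg, ← Finset.sum_neg_distrib]
    congr 1
    · refine Finset.sum_congr rfl fun i hi => ?_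
      rw [← natCast_zsmul, Int.toNat_of_nonneg (Finset.mem_filter.mp hi).2.le]
    · refine Finset.sum_congr rfl fun i hi => ?_
      rw [← natCast_zsmul, Int.toNat_of_nonneg (by have := (Finset.mem_filter.mp hi).2; omega)]
      simp
  have hx0 : x = 0 := by
    by_contra hne
    have hxs : x ∈ span ℝ S := sum_mem fun i _ => nsmul_mem (subset_span i.2) _
    refine (hpos x hxs hne).not_ge ?_
    nth_rw 2 [hxy]
    simp only [hx, hy, map_sum, LinearMap.sum_apply, map_nsmul, LinearMap.smul_apply]
    refine Finset.sum_nonpos fun i hi => smul_nonpos_of_nonneg_of_nonpos (by simp) <|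
      Finset.sum_nonpos fun j hj => smul_nonpos_of_nonneg_of_nonpos (by simp) ?_
    refine hobt _ (Subtype.coe_prop _) _ (Subtype.coe_prop _) fun h => ?_
    simp only [Finset.mem_filter] at hi hj
    rw [Subtype.ext h] at *
    tauto
  intro i hi
  by_cases hgi : 0 < g i
  · have := hzero _ _ (hx.symm.trans hx0) i (by simp [hi, hgi])
    omega
  · have := hzero _ _ (hy.symm.trans (hxy ▸ hx0)) i (by simpa [hi] using hgi)
    omega

theorem linearIndependent_real_of_int {S T : Set V} (hT : T.Finite) (hS : S.Finite)
    (hli : LinearIndependent ℤ ((↑) : S → V)) (hT' : LinearIndependent ℝ ((↑) : T → V))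
    (hST : S ⊆ span ℤ T) (hTS : T ⊆ span ℝ S) : LinearIndependent ℝ ((↑) : S → V) := by
  have := hT.fintype
  have := hS.fintype
  have hcard : Fintype.card S ≤ Fintype.card T := by
    have := linearIndependent_le_span' _ hli T (by simpa using hST)
    simpa using this
  rw [linearIndependent_iff_card_le_finrank_span]
  refine hcard.trans ?_
  have : FiniteDimensional ℝ (span ℝ S) := FiniteDimensional.span_of_finite ℝ hS
  rw [Subtype.range_coe, Set.finrank, ← Set.toFinset_card, ← finrank_span_set_eq_card hT']
  exact finrank_mono (span_le.mpr hTS)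

theorem IsPosSystem.linearIndependent_indec {Δ Q T : Set V} (hΔ : IsRootSystem Δ)
    (hT : IsBase Δ T) (hQ : IsPosSystem Δ Q) :
    LinearIndependent ℝ ((↑) : indec Q → V) := by
  obtain ⟨B, hpos, hadd⟩ := hΔ.exists_form
  have h0 := hQ.multiset_sum_ne_zero hΔ
  obtain ⟨hu, -, -⟩ := hQ
  have hQΔ : Q ⊆ Δ := hu ▸ Set.subset_union_left
  have hSQ : indec Q ⊆ Q := fun x hx => hx.1
  have hQfin : Q.Finite := hΔ.1.subset hQΔ
  have hgen := subset_closure_indec hQfin h0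
  have hle : AddSubmonoid.closure (indec Q) ≤ (span ℝ (indec Q)).toAddSubmonoid :=
    AddSubmonoid.closure_le.mpr subset_span
  refine linearIndependent_real_of_int (hΔ.1.subset hT.1) (hQfin.subset hSQ)
    (linearIndependent_int_of_obtuse B
      (fun x hx => hpos x (span_mono (hSQ.trans hQΔ) hx)) (fun x hx y hy hxy => ?_)
      (fun m hm => h0 m fun x hx => hSQ (hm x hx))) hT.2.1 (fun x hx => ?_) (fun x hx => ?_)
  · by_contra! hlt
    have hd : x - y ∈ Δ := by
      rw [sub_eq_add_neg]
      exact hadd x (hQΔ hx.1) (-y) (hΔ.2.2.1 y (hQΔ hy.1)) (by simpa using hlt)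
        (by rwa [← sub_eq_add_neg, sub_ne_zero])
    rw [hu] at hd
    rcases hd with hd | hd
    · exact hx.2 ⟨_, hd, y, hy.1, by abel⟩
    · exact hy.2 ⟨_, hd, x, hx.1, by abel⟩
  · obtain ⟨c, hc, hxc, -⟩ := hT.2.2 x (hQΔ hx.1)
    rw [hxc]
    refine sum_mem fun v hv => ?_
    simp only [Int.cast_smul_eq_zsmul]
    exact zsmul_mem (subset_span (hc hv)) _
  · have hx' := hT.1 hx
    rw [hu] at hx'
    rcases hx' with hx' | hx'
    · exact hle (hgen x hx')
    · exact neg_mem_iff.mp (hle (hgen _ hx'))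

theorem LinearIndependent.exists_linearMap_eqOn {S : Set V}
    (hS : LinearIndependent ℝ ((↑) : S → V)) (g : V → ℝ) :
    ∃ φ : V →ₗ[ℝ] ℝ, ∀ s ∈ S, φ s = g s := by
  have hS' : LinearIndepOn ℝ id S := hS
  refine ⟨(Basis.extend hS').constr ℝ fun i => g i, fun s hs => ?_⟩
  have := (Basis.extend hS').constr_basis ℝ (fun i => g i) ⟨s, hS'.subset_extend _ hs⟩
  simpa using this

theorem eq_zero_or_one_le_of_mem_closure {S : Set V} {φ : V →ₗ[ℝ] ℝ} (hφ : ∀ s ∈ S, φ s = 1)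
    {x : V} (hx : x ∈ AddSubmonoid.closure S) : x = 0 ∨ 1 ≤ φ x := by
  induction hx using AddSubmonoid.closure_induction with
  | mem x hx => exact .inr (hφ x hx).ge
  | zero => exact .inl rfl
  | add x y _ _ ihx ihy =>
    rcases ihx with rfl | ihx
    · simpa using ihy
    rcases ihy with rfl | ihy
    · simpa using Or.inr ihx
    · right
      rw [map_add]
      linarith

theorem add_ne_zero_of_mem_closure {S : Set V} (hS : LinearIndependent ℝ ((↑) : S → V))
    {a b : V} (ha : a ∈ AddSubmonoid.closure S) (hb : b ∈ AddSubmonoid.closure S)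
    (ha0 : a ≠ 0) : a + b ≠ 0 := by
  obtain ⟨φ, hφ⟩ := hS.exists_linearMap_eqOn 1
  intro h
  have h1 := (eq_zero_or_one_le_of_mem_closure hφ ha).resolve_left ha0
  have h2 := congrArg φ h
  rw [map_add, map_zero] at h2
  rcases eq_zero_or_one_le_of_mem_closure hφ hb with rfl | hb
  · rw [map_zero] at h2
    linarith
  · linarith

theorem add_notMem_of_mem_closure {S : Set V} (hS : LinearIndependent ℝ ((↑) : S → V))
    {a b : V} (ha : a ∈ AddSubmonoid.closure S) (hb : b ∈ AddSubmonoid.closure S)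
    (ha0 : a ≠ 0) (hb0 : b ≠ 0) : a + b ∉ S := by
  obtain ⟨φ, hφ⟩ := hS.exists_linearMap_eqOn 1
  intro h
  have h1 := (eq_zero_or_one_le_of_mem_closure hφ ha).resolve_left ha0
  have h2 := (eq_zero_or_one_le_of_mem_closure hφ hb).resolve_left hb0
  have h3 := hφ _ h
  rw [map_add, Pi.one_apply] at h3
  linarith

theorem exists_finsupp_of_mem_closure {S : Set V} {x : V} (hx : x ∈ AddSubmonoid.closure S) :
    ∃ c : V →₀ ℤ, ↑c.support ⊆ S ∧ x = c.sum (fun v n => (n : ℝ) • v) ∧ ∀ v, 0 ≤ c v := by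
  classical
  induction hx using AddSubmonoid.closure_induction with
  | mem x hx =>
    refine ⟨Finsupp.single x 1, fun y hy => ?_, by simp, fun v => ?_⟩
    · rwa [Finset.mem_singleton.mp (Finsupp.support_single_subset hy)]
    · rw [Finsupp.single_apply]
      split_ifs <;> simp
  | zero => exact ⟨0, by simp, by simp, by simp⟩
  | add x y _ _ ihx ihy =>
    obtain ⟨c, hc, hxc, hc0⟩ := ihx
    obtain ⟨d, hd, hyd, hd0⟩ := ihy
    refine ⟨c + d, fun v hv => ?_, ?_, fun v => add_nonneg (hc0 v) (hd0 v)⟩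
    · exact (Finset.mem_union.mp (Finsupp.support_add hv)).elim (@hc v) (@hd v)
    · rw [Finsupp.sum_add_index' (by simp) (by intros; push_cast; rw [add_smul]), ← hxc, ← hyd]

theorem IsBase.of_closure {R S : Set V} (hSR : S ⊆ R)
    (hli : LinearIndependent ℝ ((↑) : S → V))
    (h : ∀ x ∈ R, x ∈ AddSubmonoid.closure S ∨ -x ∈ AddSubmonoid.closure S) : IsBase R S := by
  refine ⟨hSR, hli, fun x hx => ?_⟩
  rcases h x hx with hx | hx
  · obtain ⟨c, hc, hxc, hc0⟩ := exists_finsupp_of_mem_closure hx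
    exact ⟨c, hc, hxc, .inl hc0⟩
  · obtain ⟨c, hc, hxc, hc0⟩ := exists_finsupp_of_mem_closure hx
    refine ⟨-c, by simpa using hc, ?_, .inr fun v => by simpa using hc0 v⟩
    rw [Finsupp.sum_neg_index (by simp), ← neg_neg x, hxc, Finsupp.sum, Finsupp.sum,
      ← Finset.sum_neg_distrib]
    simp

theorem IsBase.mem_closure_of_mem_span {Δ T I : Set V} (hT : IsBase Δ T) (hI : I ⊆ T)
    {x : V} (hx : x ∈ Δ) (hxI : x ∈ span ℝ I) :
    x ∈ AddSubmonoid.closure I ∨ -x ∈ AddSubmonoid.closure I := by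
  classical
  obtain ⟨c, hc, hxc, hsign⟩ := hT.2.2 x hx
  have hcI (v : V) (hv : v ∈ c.support) : v ∈ I := by
    by_contra hvI
    obtain ⟨φ, hφ⟩ := hT.2.1.exists_linearMap_eqOn (Pi.single v 1)
    have h1 : φ x = 0 := by
      have : span ℝ I ≤ LinearMap.ker φ := span_le.mpr fun i hi => by
        have hne : i ≠ v := fun h => hvI (h ▸ hi)
        simp [hφ i (hI hi), hne]
      exact this hxI
    have h2 : φ x = c v := by
      rw [hxc, Finsupp.sum, map_sum, Finset.sum_eq_single v]
      · simp [hφ v (hc hv)]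
      · intro w hw hwv
        simp [hφ w (hc hw), hwv]
      · exact fun h => absurd hv h
    rw [h1] at h2
    exact Finsupp.mem_support_iff.mp hv (by exact_mod_cast h2.symm)
  have key (d : V → ℕ) : ∑ v ∈ c.support, d v • v ∈ AddSubmonoid.closure I :=
    sum_mem fun v hv => nsmul_mem (AddSubmonoid.subset_closure (hcI v hv)) _
  rcases hsign with h | h
  · left
    convert key fun v => (c v).toNat
    rw [hxc, Finsupp.sum]
    refine Finset.sum_congr rfl fun v _ => ?_
    rw [← natCast_zsmul, Int.toNat_of_nonneg (h v), Int.cast_smul_eq_zsmul]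
  · right
    convert key fun v => (-c v).toNat
    rw [hxc, Finsupp.sum, ← Finset.sum_neg_distrib]
    refine Finset.sum_congr rfl fun v _ => ?_
    rw [← natCast_zsmul, Int.toNat_of_nonneg (by simpa using h v), Int.cast_smul_eq_zsmul, neg_smul]

/-- The positive system of `Δ` refining a positive system `P` of the quotient by `span ℝ I`. -/
def liftPos (Δ I : Set V) (P : Set (V ⧸ span ℝ I)) : Set V :=
  {α ∈ Δ | (span ℝ I).mkQ α ∈ P ∨ α ∈ AddSubmonoid.closure I}

theorem mkQ_eq_zero_of_mem_closure {I : Set V} {x : V} (hx : x ∈ AddSubmonoid.closure I) :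
    (span ℝ I).mkQ x = 0 := by
  have : AddSubmonoid.closure I ≤ (span ℝ I).toAddSubmonoid :=
    AddSubmonoid.closure_le.mpr subset_span
  simpa using this hx

section

variable {Δ T I : Set V} {P : Set (V ⧸ span ℝ I)}

theorem IsPosSystem.zero_notMem (hP : IsPosSystem (((span ℝ I).mkQ '' Δ) \ {0}) P) :
    (0 : V ⧸ span ℝ I) ∉ P := fun h =>
  (hP.1.symm ▸ Set.mem_union_left _ h : (0 : V ⧸ span ℝ I) ∈ ((span ℝ I).mkQ '' Δ) \ {0}).2 rfl

theorem isPosSystem_liftPos (hΔ : IsRootSystem Δ) (hT : IsBase Δ T) (hI : I ⊆ T)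
    (hP : IsPosSystem (((span ℝ I).mkQ '' Δ) \ {0}) P) : IsPosSystem Δ (liftPos Δ I P) := by
  have h0P := hP.zero_notMem
  have hIli : LinearIndependent ℝ ((↑) : I → V) := LinearIndepOn.mono (v := id) hT.2.1 hI
  refine ⟨?_, ?_, ?_⟩
  · refine Set.Subset.antisymm (fun α hα => ?_) ?_
    · by_cases h : (span ℝ I).mkQ α = 0
      · rcases hT.mem_closure_of_mem_span hI hα (by simpa using h) with h' | h'
        · exact .inl ⟨hα, .inr h'⟩
        · exact .inr ⟨hΔ.2.2.1 α hα, .inr h'⟩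
      · have : (span ℝ I).mkQ α ∈ P ∪ -P := hP.1 ▸ ⟨⟨α, hα, rfl⟩, h⟩
        rcases this with h' | h'
        · exact .inl ⟨hα, .inl h'⟩
        · exact .inr ⟨hΔ.2.2.1 α hα, .inl (by rw [map_neg]; exact h')⟩
    · rintro α (hα | hα)
      · exact hα.1
      · simpa using hΔ.2.2.1 _ hα.1
  · refine Set.eq_empty_of_forall_notMem ?_
    rintro α ⟨⟨hα, h⟩, ⟨-, h'⟩⟩
    rw [map_neg] at h'
    rcases h with h | h <;> rcases h' with h' | h'
    · exact hP.add_ne_zero h h' (by simp)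
    · have := mkQ_eq_zero_of_mem_closure h'
      rw [map_neg, neg_eq_zero] at this
      exact h0P (this ▸ h)
    · rw [mkQ_eq_zero_of_mem_closure h, neg_zero] at h'
      exact h0P h'
    · exact add_ne_zero_of_mem_closure hIli h h' (fun h => hΔ.2.1 (h ▸ hα)) (by simp)
  · rintro x ⟨hx, hxP⟩ y ⟨hy, hyP⟩ hxy
    refine ⟨hxy, ?_⟩
    rw [map_add]
    rcases hxP with h | h <;> rcases hyP with h' | h'
    · exact .inl (hP.2.2 _ h _ h' ⟨⟨x + y, hxy, map_add _ _ _⟩, hP.add_ne_zero h h'⟩)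
    · exact .inl (by rwa [mkQ_eq_zero_of_mem_closure h', add_zero])
    · exact .inl (by rwa [mkQ_eq_zero_of_mem_closure h, zero_add])
    · exact .inr (add_mem h h')

theorem subset_indec_liftPos (hΔ : IsRootSystem Δ) (hT : IsBase Δ T) (hI : I ⊆ T)
    (hP : IsPosSystem (((span ℝ I).mkQ '' Δ) \ {0}) P) : I ⊆ indec (liftPos Δ I P) := by
  intro i hi
  have h0P := hP.zero_notMem
  have hIli : LinearIndependent ℝ ((↑) : I → V) := LinearIndepOn.mono (v := id) hT.2.1 hI
  refine ⟨⟨hT.1 (hI hi), .inr (AddSubmonoid.subset_closure hi)⟩, ?_⟩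
  rintro ⟨a, ⟨ha, haP⟩, b, ⟨hb, hbP⟩, rfl⟩
  have hsum := mkQ_eq_zero_of_mem_closure (AddSubmonoid.subset_closure hi)
  rw [map_add] at hsum
  rcases haP with h | h <;> rcases hbP with h' | h'
  · exact hP.add_ne_zero h h' hsum
  · rw [mkQ_eq_zero_of_mem_closure h', add_zero] at hsum
    exact h0P (hsum ▸ h)
  · rw [mkQ_eq_zero_of_mem_closure h, zero_add] at hsum
    exact h0P (hsum ▸ h')
  · exact add_notMem_of_mem_closure hIli h h' (fun h => hΔ.2.1 (h ▸ ha))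
      (fun h => hΔ.2.1 (h ▸ hb)) hi

end

/-- if `R = π(Δ) \ {0}` is a Kostant root system and `P` is a positive system
in `R`, then the set of indecomposable elements of `P` is a base of `R`. -/
theorem stmt6 (Δ Sg₀ I : Set V) (hΔ : IsRootSystem Δ)
    (h₀ : IsBase Δ Sg₀) (hI : I ⊆ Sg₀)
    (P : Set (V ⧸ Submodule.span ℝ I))
    (hP : IsPosSystem (((Submodule.span ℝ I).mkQ '' Δ) \ {0}) P) :
    IsBase (((Submodule.span ℝ I).mkQ '' Δ) \ {0}) (indec P) := by
  set π := (span ℝ I).mkQ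
  set Q := liftPos Δ I P
  have hQ : IsPosSystem Δ Q := isPosSystem_liftPos hΔ h₀ hI hP
  have h0P : (0 : V ⧸ span ℝ I) ∉ P := hP.zero_notMem
  have hPR : P ⊆ π '' Δ \ {0} := hP.1 ▸ Set.subset_union_left
  have hQfin : Q.Finite := hΔ.1.subset fun x hx => hx.1
  have hQ0 := hQ.multiset_sum_ne_zero hΔ
  have hIQ : I ⊆ indec Q := subset_indec_liftPos hΔ h₀ hI hP
  have hQP {α : V} (hα : α ∈ Q) : π α ∈ P ∨ π α = 0 :=
    hα.2.imp_right mkQ_eq_zero_of_mem_closure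
  have hlift {ν : V ⧸ span ℝ I} (hν : ν ∈ P) : ∃ α ∈ Q, π α = ν := by
    obtain ⟨⟨α, hα, rfl⟩, -⟩ := hPR hν
    exact ⟨α, ⟨hα, .inl hν⟩, rfl⟩
  have hli : LinearIndependent ℝ ((↑) : π '' (indec Q \ I) → V ⧸ span ℝ I) := by
    have hQli : LinearIndepOn ℝ id (I ∪ indec Q \ I) := by
      rw [Set.union_sdiff_cancel hIQ]
      exact hQ.linearIndependent_indec hΔ h₀
    have := ((linearIndepOn_union_iff_quotient Set.disjoint_sdiff_right).mp hQli).2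
    rw [Set.image_id] at this
    exact this.id_image
  have hgen {ν : V ⧸ span ℝ I} (hν : ν ∈ P) :
      ν ∈ AddSubmonoid.closure (π '' (indec Q \ I)) := by
    obtain ⟨α, hα, rfl⟩ := hlift hν
    have hα' := subset_closure_indec hQfin hQ0 α hα
    clear hα hν
    induction hα' using AddSubmonoid.closure_induction with
    | mem x hx =>
      by_cases hxI : x ∈ I
      · rw [mkQ_eq_zero_of_mem_closure (AddSubmonoid.subset_closure hxI)]
        exact zero_mem _
      · exact AddSubmonoid.subset_closure ⟨x, ⟨hx, hxI⟩, rfl⟩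
    | zero => rw [map_zero]; exact zero_mem _
    | add x y _ _ ihx ihy => rw [map_add]; exact add_mem ihx ihy
  have hsub : π '' (indec Q \ I) ⊆ P := by
    rintro - ⟨σ, hσ, rfl⟩
    exact (hQP hσ.1.1).resolve_right (hli.ne_zero ⟨π σ, σ, hσ, rfl⟩)
  have heq : indec P = π '' (indec Q \ I) := by
    refine Set.Subset.antisymm ?_ fun ν hν => ⟨hsub hν, ?_⟩
    · intro ν hν
      obtain ⟨α, hα, rfl⟩ := hlift hν.1
      revert hν
      refine decomposition_induction (p := fun α => π α ∈ indec P → π α ∈ π '' (indec Q \ I))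
        hQfin hQ0 (fun α hα ih hν => ?_) α hα
      by_cases hdec : ∃ a ∈ Q, ∃ b ∈ Q, α = a + b
      · obtain ⟨a, ha, b, hb, hab⟩ := hdec
        obtain ⟨iha, ihb⟩ := ih a ha b hb hab
        have hπab : π α = π a + π b := by rw [hab, map_add]
        rcases hQP ha with h | h
        · rcases hQP hb with h' | h'
          · exact absurd ⟨_, h, _, h', hπab⟩ hν.2
          · rw [h', add_zero] at hπab
            rw [hπab] at hν ⊢
            exact iha hν
        · rw [h, zero_add] at hπab
          rw [hπab] at hν ⊢
          exact ihb hν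
      · refine ⟨α, ⟨⟨hα, hdec⟩, fun hαI => h0P ?_⟩, rfl⟩
        exact mkQ_eq_zero_of_mem_closure (AddSubmonoid.subset_closure hαI) ▸ hν.1
    · rintro ⟨a, ha, b, hb, rfl⟩
      exact add_notMem_of_mem_closure hli (hgen ha) (hgen hb) (ne_of_mem_of_not_mem ha h0P)
        (ne_of_mem_of_not_mem hb h0P) hν
  refine IsBase.of_closure (fun ν hν => hPR hν.1) (heq ▸ hli) fun ν hν => ?_
  rw [heq]
  rw [hP.1] at hν
  exact hν.imp hgen hgen
end

section
/- Let $\mathfrak{s}$ be a complex semisimple Lie algebra with weight lattice $\Lambda$ and root lattice $Q$. Let $V$ be a finite-dimensional semisimple $\mathfrak{s}$-module all of whose weights lie in a single coset of $\Lambda/Q$ and all of whose weight spaces are one-dimensional. Then $V$ is irreducible. -/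
open LieModule LieAlgebra LieAlgebra.IsKilling

section CartanWeights

variable {L M : Type*} [LieRing L] [LieAlgebra ℂ L]
  [AddCommGroup M] [Module ℂ M] [LieRingModule L M] [LieModule ℂ L M]
  {H : LieSubalgebra ℂ L} [H.IsCartanSubalgebra]

/-- `χ` is a weight of the submodule `N`: some nonzero vector of `N` has generalized weight `χ`. -/
def LieSubmodule.HasWeight (N : LieSubmodule ℂ L M) (χ : H → ℂ) : Prop :=
  ∃ v ∈ N, v ≠ 0 ∧ v ∈ genWeightSpace M χ

theorem LieSubmodule.HasWeight.genWeightSpace_ne_bot {N : LieSubmodule ℂ L M} {χ : H → ℂ}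
    (h : N.HasWeight χ) : genWeightSpace M χ ≠ ⊥ := by
  obtain ⟨v, -, hv0, hv⟩ := h
  intro hbot
  rw [hbot] at hv
  exact hv0 (by simpa using hv)

variable [FiniteDimensional ℂ M]

theorem LieSubmodule.exists_hasWeight {N : LieSubmodule ℂ L M} (hN : N ≠ ⊥) :
    ∃ χ : H → ℂ, N.HasWeight χ := by
  have : Nontrivial N := (LieSubmodule.nontrivial_iff_ne_bot ℂ L M).mpr hN
  obtain ⟨χ⟩ : Nonempty (Weight ℂ H N) := by
    by_contra! hempty
    simpa only [iSup_of_empty, bot_ne_top] using iSup_genWeightSpace_eq_top' ℂ H N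
  obtain ⟨v, hv, hv0⟩ := χ.exists_ne_zero
  refine ⟨χ, v, v.2, by simpa using hv0, ?_⟩
  exact map_genWeightSpace_le (f := N.incl.restrictLie H) (Submodule.mem_map_of_mem hv)

theorem LieModule.lie_eq_smul_of_finrank_genWeightSpace_eq_one {χ : H → ℂ}
    (h1 : Module.finrank ℂ (genWeightSpace M χ) = 1) {v : M} (hv : v ∈ genWeightSpace M χ)
    (x : H) : ⁅x, v⁆ = χ x • v := by
  have hne : genWeightSpace M χ ≠ ⊥ := by
    intro h
    have : Module.finrank ℂ (⊥ : LieSubmodule ℂ H M) = 0 := finrank_bot ℂ M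
    rw [h, this] at h1
    exact zero_ne_one h1
  obtain ⟨w, hw0, hw⟩ := exists_forall_lie_eq_smul ℂ H M ⟨χ, hne⟩
  have hwmem : w ∈ genWeightSpace M χ :=
    weightSpace_le_genWeightSpace M χ ((mem_weightSpace χ w).mpr hw)
  obtain ⟨c, hc⟩ := (finrank_eq_one_iff_of_nonzero' (⟨w, hwmem⟩ : genWeightSpace M χ)
    (by simpa using hw0)).mp h1 ⟨v, hv⟩
  obtain rfl : c • w = v := congrArg Subtype.val hc
  rw [lie_smul, hw, smul_comm]
  rfl

variable [FiniteDimensional ℂ L] [IsKilling ℂ L]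

theorem LieSubmodule.HasWeight.add_root_or_exists_nat {N : LieSubmodule ℂ L M} {χ : H → ℂ}
    (h1 : Module.finrank ℂ (genWeightSpace M χ) = 1) (h : N.HasWeight χ)
    {α : Weight ℂ H L} (hα : α.IsNonZero) :
    N.HasWeight ((α : H → ℂ) + χ) ∨ ∃ n : ℕ, χ (coroot α) = n := by
  obtain ⟨v, hvN, hv0, hv⟩ := h
  obtain ⟨x, e, f, ht, he, hf⟩ := exists_isSl2Triple_of_weight_isNonZero hα
  by_cases hev : ⁅e, v⁆ = 0
  · right
    have hx : x = coroot α := ht.h_eq_coroot hα he hf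
    have P : ht.HasPrimitiveVectorWith v (χ (coroot α)) :=
      ⟨hv0, by rw [hx]; exact lie_eq_smul_of_finrank_genWeightSpace_eq_one h1 hv (coroot α), hev⟩
    exact P.exists_nat
  · exact Or.inl ⟨_, N.lie_mem hvN, hev, lie_mem_genWeightSpace_of_mem_genWeightSpace he hv⟩

theorem LieSubmodule.HasWeight.sub_root_or_exists_nat {N : LieSubmodule ℂ L M} {χ : H → ℂ}
    (h1 : Module.finrank ℂ (genWeightSpace M χ) = 1) (h : N.HasWeight χ)
    {α : Weight ℂ H L} (hα : α.IsNonZero) :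
    N.HasWeight (χ - (α : H → ℂ)) ∨ ∃ n : ℕ, χ (coroot α) = -n := by
  have hneg : χ (-coroot α) = -χ (coroot α) :=
    map_neg (Weight.toLinear ℂ H M ⟨χ, h.genWeightSpace_ne_bot⟩) (coroot α)
  obtain h' | ⟨n, hn⟩ := h.add_root_or_exists_nat h1 hα.neg
  · left
    rwa [Weight.coe_neg, neg_add_eq_sub] at h'
  · right
    refine ⟨n, ?_⟩
    rw [coroot_neg, hneg] at hn
    rw [← hn, neg_neg]

/-- Two roots whose pairing is negative add up to a root or to zero. -/
theorem LieAlgebra.IsKilling.rootSpace_add_ne_bot_or_exists_nat (α β : Weight ℂ H L)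
    (hα : α.IsNonZero) :
    rootSpace H (α + β : H → ℂ) ≠ ⊥ ∨ ∃ n : ℕ, β (coroot α) = n := by
  rcases Nat.eq_zero_or_pos (chainTopCoeff α β) with h | h
  · right
    exact ⟨chainBotCoeff α β, by simp [apply_coroot_eq_cast, h]⟩
  · left
    have := (rootSpace_zsmul_add_ne_bot_iff α β hα 1).mpr ⟨by lia, by lia⟩
    rwa [one_smul] at this

/-- Two submodules with one-dimensional weight spaces whose weights lie in the same coset of the
root lattice share a weight. -/
theorem LieSubmodule.HasWeight.exists_common
    (h1 : ∀ χ : H → ℂ, genWeightSpace M χ ≠ ⊥ → Module.finrank ℂ (genWeightSpace M χ) = 1)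
    {N N' : LieSubmodule ℂ L M} (l : List (Weight ℂ H L)) (hl : ∀ α ∈ l, α.IsNonZero)
    {χ χ' : H → ℂ} (hχ : N.HasWeight χ) (hχ' : N'.HasWeight χ')
    (hsum : χ - χ' = (l.map fun α : Weight ℂ H L ↦ (α : H → ℂ)).sum) :
    ∃ ψ : H → ℂ, N.HasWeight ψ ∧ N'.HasWeight ψ := by
  classical
  induction hn : l.length using Nat.strong_induction_on generalizing l χ χ' with
  | _ n ih =>
  obtain _ | ⟨α, t⟩ := l
  · obtain rfl : χ = χ' := sub_eq_zero.mp hsum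
    exact ⟨χ, hχ, hχ'⟩
  have hα : α.IsNonZero := hl α (by simp)
  have ht : ∀ β ∈ t, β.IsNonZero := fun β hβ ↦ hl β (by simp [hβ])
  simp only [List.map_cons, List.sum_cons] at hsum
  simp only [List.length_cons] at hn
  by_cases hred : ∃ β ∈ t, rootSpace H (α + β : H → ℂ) ≠ ⊥
  · obtain ⟨β, hβ, hαβ⟩ := hred
    have hperm := ((List.perm_cons_erase hβ).map fun γ : Weight ℂ H L ↦ (γ : H → ℂ)).sum_eq
    have hlen := List.length_erase_of_mem hβ
    have hpos := List.length_pos_of_mem hβ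
    have herase : ∀ γ ∈ t.erase β, γ.IsNonZero := fun γ hγ ↦ ht γ (List.mem_of_mem_erase hγ)
    simp only [List.map_cons, List.sum_cons] at hperm
    rw [hperm, ← add_assoc] at hsum
    by_cases h0 : (α + β : H → ℂ) = 0
    · rw [h0, zero_add] at hsum
      exact ih _ (by lia) _ herase hχ hχ' hsum rfl
    · refine ih _ ?_ (⟨α + β, hαβ⟩ :: t.erase β) ?_ hχ hχ' (by simpa using hsum) rfl
      · simp only [List.length_cons]
        lia
      · simp only [List.mem_cons, forall_eq_or_imp]
        exact ⟨h0, herase⟩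
  · push Not at hred
    have hpair : ∃ n : ℕ, (t.map fun γ : Weight ℂ H L ↦ (γ : H → ℂ)).sum (coroot α) = n := by
      clear hsum hn ih hl ht
      induction t with
      | nil => exact ⟨0, by simp⟩
      | cons β t iht =>
        obtain ⟨a, ha⟩ := iht fun γ hγ ↦ hred γ (by simp [hγ])
        obtain ⟨b, hb⟩ := (rootSpace_add_ne_bot_or_exists_nat α β hα).resolve_left
          (not_not.mpr (hred β (by simp)))
        exact ⟨b + a, by simp [ha, hb]⟩
    obtain h | ⟨a, ha⟩ := hχ.sub_root_or_exists_nat (h1 _ hχ.genWeightSpace_ne_bot) hα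
    · exact ih _ (by lia) t ht h hχ' (by rw [sub_right_comm, hsum, add_sub_cancel_left]) rfl
    obtain h | ⟨b, hb⟩ := hχ'.add_root_or_exists_nat (h1 _ hχ'.genWeightSpace_ne_bot) hα
    · refine ih _ (by lia) t ht hχ h ?_ rfl
      rw [add_comm, ← sub_sub, hsum, add_sub_cancel_left]
    obtain ⟨c, hc⟩ := hpair
    have heval := congrFun hsum (coroot α)
    simp only [Pi.sub_apply, Pi.add_apply, ha, hb, hc, root_apply_coroot hα] at heval
    have : ((a + b + c + 2 : ℕ) : ℂ) = 0 := by
      push_cast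
      linear_combination -heval
    exact absurd (Nat.cast_eq_zero.mp this) (by lia)

/-- Every element of the root lattice is a sum of roots. -/
theorem LieAlgebra.IsKilling.exists_list_sum_eq_of_mem_closure {γ : H → ℂ}
    (hγ : γ ∈ AddSubgroup.closure {α : H → ℂ | α ≠ 0 ∧ rootSpace H α ≠ ⊥}) :
    ∃ l : List (Weight ℂ H L), (∀ α ∈ l, α.IsNonZero) ∧
      γ = (l.map fun α : Weight ℂ H L ↦ (α : H → ℂ)).sum := by
  induction hγ using AddSubgroup.closure_induction with
  | mem α hα => exact ⟨[⟨α, hα.2⟩], by simpa using! hα.1, by simp⟩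
  | zero => exact ⟨[], by simp, by simp⟩
  | add x y _ _ hx hy =>
    obtain ⟨l, hl, rfl⟩ := hx
    obtain ⟨l', hl', rfl⟩ := hy
    refine ⟨l ++ l', fun α hα ↦ ?_, by simp⟩
    exact (List.mem_append.mp hα).elim (hl α) (hl' α)
  | neg x hx ih =>
    obtain ⟨l, hl, rfl⟩ := ih
    refine ⟨l.map Neg.neg, ?_, ?_⟩
    · intro β hβ
      obtain ⟨α, hα, rfl⟩ := List.mem_map.mp hβ
      exact (hl α hα).neg
    · clear hl hx
      induction l with
      | nil => simp
      | cons α l ih =>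
        simp only [List.map_cons, List.sum_cons, neg_add, ih, Weight.coe_neg]

end CartanWeights

/-- let `L` be a complex semisimple Lie algebra with Cartan subalgebra `H`,
and `M` a nonzero finite-dimensional semisimple `L`-module all of whose weights lie in a
single coset of the weight lattice modulo the root lattice (i.e. any two weights differ by
an element of the additive group generated by the roots) and all of whose weight spaces
are one-dimensional.  Then `M` is irreducible. -/
theorem stmt13 (L : Type*) [LieRing L] [LieAlgebra ℂ L] [FiniteDimensional ℂ L]
    [LieAlgebra.IsSemisimple ℂ L]
    (M : Type*) [AddCommGroup M] [Module ℂ M] [LieRingModule L M] [LieModule ℂ L M]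
    [FiniteDimensional ℂ M] [Nontrivial M]
    (H : LieSubalgebra ℂ L) [H.IsCartanSubalgebra]
    -- `M` is semisimple (every Lie submodule is complemented):
    (hss : ∀ N : LieSubmodule ℂ L M, ∃ N' : LieSubmodule ℂ L M, IsCompl N N')
    -- all weight spaces are one-dimensional:
    (h1 : ∀ χ : H → ℂ, LieModule.genWeightSpace M χ ≠ ⊥ →
      Module.finrank ℂ (LieModule.genWeightSpace M χ) = 1)
    -- all weights lie in a single coset of the root lattice `Q`:
    (hcoset : ∀ χ₁ χ₂ : H → ℂ,
      LieModule.genWeightSpace M χ₁ ≠ ⊥ → LieModule.genWeightSpace M χ₂ ≠ ⊥ →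
        χ₁ - χ₂ ∈ AddSubgroup.closure
          {α : H → ℂ | α ≠ 0 ∧ LieAlgebra.rootSpace H α ≠ ⊥}) :
    LieModule.IsIrreducible ℂ L M := by
  refine LieModule.IsIrreducible.mk fun N hN ↦ ?_
  obtain ⟨N', hc⟩ := hss N
  by_contra htop
  have hN' : N' ≠ ⊥ := fun h ↦ htop (eq_top_of_isCompl_bot (h ▸ hc))
  obtain ⟨χ, hχ⟩ := N.exists_hasWeight (H := H) hN
  obtain ⟨χ', hχ'⟩ := N'.exists_hasWeight (H := H) hN'
  obtain ⟨l, hl, hsum⟩ := exists_list_sum_eq_of_mem_closure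
    (hcoset χ χ' hχ.genWeightSpace_ne_bot hχ'.genWeightSpace_ne_bot)
  obtain ⟨ψ, hψ, v', hv'N, hv'0, hv'⟩ := hχ.exists_common h1 l hl hχ' hsum
  have hfin := h1 ψ hψ.genWeightSpace_ne_bot
  obtain ⟨v, hvN, hv0, hv⟩ := hψ
  obtain ⟨c, hc'⟩ := (finrank_eq_one_iff_of_nonzero' (⟨v, hv⟩ : genWeightSpace M ψ)
    (by simpa using hv0)).mp hfin ⟨v', hv'⟩
  obtain rfl : c • v = v' := congrArg Subtype.val hc'
  have hmem : c • v ∈ N ⊓ N' := ⟨N.smul_mem c hvN, hv'N⟩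
  rw [hc.inf_eq_bot] at hmem
  exact hv'0 (by simpa using hmem)
end

section
/- Let $\mathfrak{g}$ be a complex semisimple Lie algebra, $\mathfrak{t}$ a toral subalgebra with $\mathfrak{t} = \mathfrak{z}(\mathfrak{c}_{\mathfrak{g}}(\mathfrak{t}))$, and let $\mathfrak{g} = \mathfrak{m} \oplus \bigoplus_{\nu \in R} \mathfrak{g}_\nu$ be the $\mathfrak{t}$-weight decomposition. If $\mu, \nu, \mu + \nu \in R$, then $[\mathfrak{g}_\mu, \mathfrak{g}_\nu] = \mathfrak{g}_{\mu+\nu}$. -/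
variable {L : Type*} [LieRing L] [LieAlgebra ℂ L]

/-- The `ν`-eigenspace of the adjoint action of `t` on `L`. -/
def wtSpace (t : LieSubalgebra ℂ L) (ν : Module.Dual ℂ t) : Submodule ℂ L where
  carrier := {x | ∀ s : t, ⁅(s : L), x⁆ = ν s • x}
  add_mem' := by
    intro a b ha hb s
    rw [lie_add, ha s, hb s, smul_add]
  zero_mem' := by
    intro s
    simp
  smul_mem' := by
    intro c x hx s
    rw [lie_smul, hx s, smul_comm]

theorem lie_mem_wtSpace_add {t : LieSubalgebra ℂ L} {μ ν : Module.Dual ℂ t} {x y : L}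
    (hx : x ∈ wtSpace t μ) (hy : y ∈ wtSpace t ν) : ⁅x, y⁆ ∈ wtSpace t (μ + ν) := by
  intro s
  rw [leibniz_lie, hx s, hy s, smul_lie, lie_smul, ← add_smul, LinearMap.add_apply]

theorem mem_wtSpace_zero {t : LieSubalgebra ℂ L} {x : L} :
    x ∈ wtSpace t 0 ↔ ∀ s ∈ t, ⁅s, x⁆ = 0 :=
  ⟨fun h s hs => by simpa using h ⟨s, hs⟩, fun h s => by simpa using h s s.2⟩

theorem iSup_wtSpace_eq_top [FiniteDimensional ℂ L] (t : LieSubalgebra ℂ L) [IsLieAbelian t]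
    (hsemi : ∀ x ∈ t, (LieAlgebra.ad ℂ L x).IsSemisimple) :
    ⨆ ν : Module.Dual ℂ t, wtSpace t ν = ⊤ := by
  have h := LieModule.iSup_genWeightSpace_eq_top' ℂ t L
  rw [← LieSubmodule.toSubmodule_inj, LieSubmodule.iSup_toSubmodule,
    LieSubmodule.top_toSubmodule] at h
  rw [eq_top_iff, ← h]
  refine iSup_le fun χ => le_trans ?_ (le_iSup _ χ.toLinear)
  intro x hx s
  rw [LieSubmodule.mem_toSubmodule, LieModule.mem_genWeightSpace] at hx
  obtain ⟨k, hk⟩ := hx s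
  have hs : (LieModule.toEnd ℂ t L s).IsFinitelySemisimple :=
    (hsemi s s.2).isFinitelySemisimple
  have : x ∈ (LieModule.toEnd ℂ t L s).maxGenEigenspace (χ s) :=
    Module.End.mem_maxGenEigenspace _ _ _ |>.2 ⟨k, hk⟩
  rw [hs.maxGenEigenspace_eq_eigenspace, Module.End.mem_eigenspace_iff] at this
  exact this

theorem killingForm_eq_zero_of_mem_wtSpace {t : LieSubalgebra ℂ L} {μ ν : Module.Dual ℂ t}
    (h : μ + ν ≠ 0) {x y : L} (hx : x ∈ wtSpace t μ) (hy : y ∈ wtSpace t ν) :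
    killingForm ℂ L x y = 0 := by
  obtain ⟨s, hs⟩ : ∃ s, (μ + ν) s ≠ 0 := by
    by_contra! hc
    exact h (LinearMap.ext hc)
  have h1 := LieModule.traceForm_apply_lie_apply ℂ L L x (s : L) y
  rw [← lie_skew, hx s, hy s] at h1
  simp only [map_neg, map_smul, LinearMap.neg_apply, LinearMap.smul_apply, smul_eq_mul] at h1
  have h2 : (μ + ν) s * killingForm ℂ L x y = 0 := by
    rw [LinearMap.add_apply, add_mul]
    linear_combination -h1
  exact (mul_eq_zero.1 h2).resolve_left hs

theorem exists_mem_wtSpace_killingForm_eq [FiniteDimensional ℂ L] [LieAlgebra.IsKilling ℂ L]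
    {t : LieSubalgebra ℂ L} (htop : ⨆ ν : Module.Dual ℂ t, wtSpace t ν = ⊤)
    (σ : Module.Dual ℂ t) (f : Module.Dual ℂ L) :
    ∃ z ∈ wtSpace t (-σ), ∀ y ∈ wtSpace t σ, killingForm ℂ L z y = f y := by
  obtain ⟨z, rfl⟩ : ∃ z, killingForm ℂ L z = f :=
    ⟨_, LinearMap.ext (LinearMap.BilinForm.apply_toDual_symm_apply
      (hB := LieAlgebra.IsKilling.killingForm_nondegenerate ℂ L) f)⟩
  have hz : z ∈ ⨆ ν : Module.Dual ℂ t, wtSpace t ν := htop ▸ Submodule.mem_top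
  induction hz using Submodule.iSup_induction' with
  | mem ν x hx =>
    by_cases h : ν = -σ
    · exact ⟨x, h ▸ hx, fun _ _ => rfl⟩
    · refine ⟨0, zero_mem _, fun y hy => ?_⟩
      rw [killingForm_eq_zero_of_mem_wtSpace _ hx hy]
      · simp
      · rwa [Ne, ← eq_neg_iff_add_eq_zero]
  | zero => exact ⟨0, zero_mem _, fun _ _ => rfl⟩
  | add x y _ _ ihx ihy =>
    obtain ⟨a, ha, ha'⟩ := ihx
    obtain ⟨b, hb, hb'⟩ := ihy
    exact ⟨a + b, add_mem ha hb, fun w hw => by simp [ha' w hw, hb' w hw]⟩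

theorem eq_zero_of_forall_mem_wtSpace_neg [FiniteDimensional ℂ L] [LieAlgebra.IsKilling ℂ L]
    {t : LieSubalgebra ℂ L} (htop : ⨆ ν : Module.Dual ℂ t, wtSpace t ν = ⊤)
    {σ : Module.Dual ℂ t} {z : L} (hz : z ∈ wtSpace t σ)
    (h : ∀ y ∈ wtSpace t (-σ), killingForm ℂ L z y = 0) : z = 0 := by
  have hker : z ∈ LinearMap.ker (killingForm ℂ L) := by
    rw [LinearMap.mem_ker]
    ext y
    have hy : y ∈ ⨆ ν : Module.Dual ℂ t, wtSpace t ν := htop ▸ Submodule.mem_top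
    induction hy using Submodule.iSup_induction' with
    | mem ν y hy =>
      by_cases hν : ν = -σ
      · simpa using h y (hν ▸ hy)
      · simpa using killingForm_eq_zero_of_mem_wtSpace
          (fun h0 => hν (eq_neg_of_add_eq_zero_right h0)) hz hy
    | zero => simp
    | add x y _ _ ihx ihy => simp_all
  simpa using hker

/-- Traces of the adjoint action on `V`, on the elements of `L` that preserve `V`. -/
theorem exists_dual_eq_trace_restrict (V : Submodule ℂ L) :
    ∃ θ : Module.Dual ℂ L, ∀ x (hx : ∀ v ∈ V, LieAlgebra.ad ℂ L x v ∈ V),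
      θ x = LinearMap.trace ℂ V ((LieAlgebra.ad ℂ L x).restrict hx) := by
  obtain ⟨P, hP⟩ := V.subtype.exists_leftInverse_of_injective V.ker_subtype
  refine ⟨LinearMap.trace ℂ V ∘ₗ LinearMap.lcomp ℂ V V.subtype ∘ₗ LinearMap.llcomp ℂ L L V P ∘ₗ
    (LieAlgebra.ad ℂ L : L →ₗ[ℂ] Module.End ℂ L), fun x hx => ?_⟩
  simp only [LinearMap.comp_apply]
  congr 1
  ext v
  have := LinearMap.congr_fun hP ((LieAlgebra.ad ℂ L x).restrict hx v)
  simpa using congrArg Subtype.val this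

theorem apply_lie_eq_zero_of_eq_trace_restrict {V : Submodule ℂ L} {θ : Module.Dual ℂ L}
    (hθ : ∀ x (hx : ∀ v ∈ V, LieAlgebra.ad ℂ L x v ∈ V),
      θ x = LinearMap.trace ℂ V ((LieAlgebra.ad ℂ L x).restrict hx))
    {x y : L} (hx : ∀ v ∈ V, ⁅x, v⁆ ∈ V) (hy : ∀ v ∈ V, ⁅y, v⁆ ∈ V) : θ ⁅x, y⁆ = 0 := by
  have hxy : ∀ v ∈ V, LieAlgebra.ad ℂ L ⁅x, y⁆ v ∈ V := fun v hv => by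
    rw [LieAlgebra.ad_apply, lie_lie]
    exact sub_mem (hx _ (hy v hv)) (hy _ (hx v hv))
  have hr : (LieAlgebra.ad ℂ L ⁅x, y⁆).restrict hxy =
      (LieAlgebra.ad ℂ L x).restrict hx * (LieAlgebra.ad ℂ L y).restrict hy -
      (LieAlgebra.ad ℂ L y).restrict hy * (LieAlgebra.ad ℂ L x).restrict hx := by
    ext v
    exact lie_lie x y (v : L)
  rw [hθ _ hxy, hr, map_sub, LinearMap.trace_mul_comm, sub_self]

/-- The trace of an endomorphism preserving a sum of subspaces of eigenvectors is a sum of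
`finrank` many of the corresponding eigenvalues. -/
theorem exists_multiset_sum_eq_trace_restrict {E ι : Type*} [AddCommGroup E] [Module ℂ E]
    [FiniteDimensional ℂ E] (T : Module.End ℂ E) (W : ι → Submodule ℂ E) (c : ι → ℂ)
    (hW : ∀ i, W i ≤ T.eigenspace (c i)) (hT : ∀ v ∈ ⨆ i, W i, T v ∈ ⨆ i, W i) :
    ∃ s : Multiset ℂ, s.card = Module.finrank ℂ (⨆ i, W i : Submodule ℂ E) ∧
      (∀ a ∈ s, ∃ i, c i = a) ∧ LinearMap.trace ℂ _ (T.restrict hT) = s.sum := by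
  refine ⟨(T.restrict hT).charpoly.roots, ?_, fun a ha => ?_, ?_⟩
  · rw [← LinearMap.charpoly_natDegree (T.restrict hT)]
    exact (IsAlgClosed.splits _).natDegree_eq_card_roots.symm
  · have hev := (Module.End.hasEigenvalue_iff_isRoot_charpoly _ _).2
      (Polynomial.isRoot_of_mem_roots ha)
    obtain ⟨v, hv⟩ := hev.exists_hasEigenvector
    by_contra! hc
    have h1 : (v : E) ∈ T.eigenspace a := by
      rw [Module.End.mem_eigenspace_iff]
      simpa using congrArg Subtype.val hv.apply_eq_smul
    have h2 : (v : E) ∈ ⨆ b, ⨆ _ : b ≠ a, T.eigenspace b :=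
      iSup_le (fun i => (hW i).trans (le_iSup₂_of_le (c i) (hc i) le_rfl)) v.2
    have h3 := Submodule.disjoint_def.1 (T.eigenspaces_iSupIndep a) _ h1 h2
    exact hv.2 (Subtype.ext h3)
  · exact Module.End.trace_eq_sum_roots_charpoly_of_splits (IsAlgClosed.splits _)

theorem exists_mem_killingForm_eq_of_apply_lie_eq_zero [FiniteDimensional ℂ L]
    [LieAlgebra.IsKilling ℂ L] {t : LieSubalgebra ℂ L}
    (htop : ⨆ ν : Module.Dual ℂ t, wtSpace t ν = ⊤)
    (hz : (t : Set L) =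
      {x : L | (∀ s ∈ t, ⁅s, x⁆ = 0) ∧ ∀ y : L, (∀ s ∈ t, ⁅s, y⁆ = 0) → ⁅x, y⁆ = 0})
    {θ : Module.Dual ℂ L} (hθ : ∀ a ∈ wtSpace t 0, ∀ b ∈ wtSpace t 0, θ ⁅a, b⁆ = 0) :
    ∃ u ∈ t, ∀ x ∈ wtSpace t 0, killingForm ℂ L u x = θ x := by
  obtain ⟨u, hu, hux⟩ := exists_mem_wtSpace_killingForm_eq htop 0 θ
  rw [neg_zero] at hu
  refine ⟨u, ?_, hux⟩
  rw [← SetLike.mem_coe, hz]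
  refine ⟨mem_wtSpace_zero.1 hu, fun y hy => ?_⟩
  have hy : y ∈ wtSpace t 0 := mem_wtSpace_zero.2 hy
  have huy : ⁅u, y⁆ ∈ wtSpace t 0 := by simpa using lie_mem_wtSpace_add hu hy
  refine eq_zero_of_forall_mem_wtSpace_neg htop huy fun a ha => ?_
  rw [neg_zero] at ha
  have hya : ⁅y, a⁆ ∈ wtSpace t 0 := by simpa using lie_mem_wtSpace_add hy ha
  rw [LieModule.traceForm_apply_lie_apply, hux _ hya, hθ y hy a ha]

theorem mem_wtSpace_zero_of_mem (t : LieSubalgebra ℂ L) [IsLieAbelian t] {s : L} (hs : s ∈ t) :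
    s ∈ wtSpace t 0 :=
  mem_wtSpace_zero.2 fun r hr => congrArg Subtype.val (trivial_lie_zero t t ⟨r, hr⟩ ⟨s, hs⟩)

theorem eq_zero_of_mem_of_forall_killingForm_eq_zero [FiniteDimensional ℂ L]
    [LieAlgebra.IsKilling ℂ L] {t : LieSubalgebra ℂ L} [IsLieAbelian t]
    (htop : ⨆ ν : Module.Dual ℂ t, wtSpace t ν = ⊤)
    (hz : (t : Set L) =
      {x : L | (∀ s ∈ t, ⁅s, x⁆ = 0) ∧ ∀ y : L, (∀ s ∈ t, ⁅s, y⁆ = 0) → ⁅x, y⁆ = 0})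
    {s : L} (hs : s ∈ t) (h : ∀ r ∈ t, killingForm ℂ L r s = 0) : s = 0 := by
  have hcomm : ∀ v : L, ⁅s, v⁆ = 0 := by
    intro v
    have hv : v ∈ ⨆ ν : Module.Dual ℂ t, wtSpace t ν := htop ▸ Submodule.mem_top
    induction hv using Submodule.iSup_induction' with
    | zero => simp
    | add x y _ _ ihx ihy => rw [lie_add, ihx, ihy, add_zero]
    | mem ρ v hv =>
      obtain ⟨θ, hθ⟩ := exists_dual_eq_trace_restrict (wtSpace t ρ)
      have hstab : ∀ x ∈ wtSpace t 0, ∀ v ∈ wtSpace t ρ, ⁅x, v⁆ ∈ wtSpace t ρ :=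
        fun x hx v hv => by simpa using lie_mem_wtSpace_add hx hv
      obtain ⟨u, hu, hux⟩ := exists_mem_killingForm_eq_of_apply_lie_eq_zero htop hz
        (fun a ha b hb => apply_lie_eq_zero_of_eq_trace_restrict hθ (hstab a ha) (hstab b hb))
      have hs0 := mem_wtSpace_zero_of_mem t hs
      have htr := hux s hs0
      have hscal : (LieAlgebra.ad ℂ L s).restrict (hstab s hs0) =
          ρ ⟨s, hs⟩ • (LinearMap.id : Module.End ℂ (wtSpace t ρ)) := by
        ext w
        exact w.2 ⟨s, hs⟩
      rw [h u hu, hθ s (hstab s hs0), hscal, map_smul, LinearMap.trace_id, smul_eq_mul,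
        eq_comm, mul_eq_zero] at htr
      rw [hv ⟨s, hs⟩]
      rcases htr with h0 | h0
      · rw [h0, zero_smul]
      · have hbot := Submodule.finrank_eq_zero.1 (Nat.cast_eq_zero.1 h0)
        rw [hbot] at hv
        rw [(Submodule.mem_bot ℂ).1 hv, smul_zero]
  have hker : s ∈ LinearMap.ker (killingForm ℂ L) := by
    have had : LieAlgebra.ad ℂ L s = 0 := LinearMap.ext hcomm
    rw [LinearMap.mem_ker]
    ext y
    rw [killingForm_apply_apply, had]
    simp
  simpa using hker

theorem exists_mem_killingForm_eq_dual [FiniteDimensional ℂ L]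
    [LieAlgebra.IsKilling ℂ L] {t : LieSubalgebra ℂ L} [IsLieAbelian t]
    (htop : ⨆ ν : Module.Dual ℂ t, wtSpace t ν = ⊤)
    (hz : (t : Set L) =
      {x : L | (∀ s ∈ t, ⁅s, x⁆ = 0) ∧ ∀ y : L, (∀ s ∈ t, ⁅s, y⁆ = 0) → ⁅x, y⁆ = 0})
    (l : Module.Dual ℂ t) : ∃ H : t, ∀ s : t, killingForm ℂ L s H = l s := by
  let φ : t →ₗ[ℂ] Module.Dual ℂ t :=
    (killingForm ℂ L).flip.domRestrict₁₂ t.toSubmodule t.toSubmodule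
  have hφ : Function.Injective φ := by
    rw [injective_iff_map_eq_zero]
    intro s hs
    exact Subtype.ext (eq_zero_of_mem_of_forall_killingForm_eq_zero htop hz s.2
      fun r hr => LinearMap.congr_fun hs ⟨r, hr⟩)
  obtain ⟨H, hH⟩ := (LinearMap.injective_iff_surjective_of_finrank_eq_finrank
    Subspace.dual_finrank_eq.symm).1 hφ l
  exact ⟨H, fun s => LinearMap.congr_fun hH s⟩

theorem trace_restrict_eq_zero_of_stable [FiniteDimensional ℂ L]
    [LieAlgebra.IsKilling ℂ L] {t : LieSubalgebra ℂ L} [IsLieAbelian t]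
    (htop : ⨆ ν : Module.Dual ℂ t, wtSpace t ν = ⊤)
    (hz : (t : Set L) =
      {x : L | (∀ s ∈ t, ⁅s, x⁆ = 0) ∧ ∀ y : L, (∀ s ∈ t, ⁅s, y⁆ = 0) → ⁅x, y⁆ = 0})
    {l : Module.Dual ℂ t} {H : t} (hH : ∀ s : t, killingForm ℂ L s H = l s)
    {z w : L} (hzl : z ∈ wtSpace t l) (hwl : w ∈ wtSpace t (-l)) (hzw : killingForm ℂ L z w ≠ 0)
    {V : Submodule ℂ L} (h0 : ∀ x ∈ wtSpace t 0, ∀ v ∈ V, ⁅x, v⁆ ∈ V)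
    (hzV : ∀ v ∈ V, ⁅z, v⁆ ∈ V) (hwV : ∀ v ∈ V, ⁅w, v⁆ ∈ V)
    (hHV : ∀ v ∈ V, LieAlgebra.ad ℂ L H v ∈ V) :
    LinearMap.trace ℂ V ((LieAlgebra.ad ℂ L H).restrict hHV) = 0 := by
  obtain ⟨θ, hθ⟩ := exists_dual_eq_trace_restrict V
  obtain ⟨u, hu, hux⟩ := exists_mem_killingForm_eq_of_apply_lie_eq_zero htop hz
    (fun a ha b hb => apply_lie_eq_zero_of_eq_trace_restrict hθ (h0 a ha) (h0 b hb))
  have hm : ⁅z, w⁆ ∈ wtSpace t 0 := by simpa using lie_mem_wtSpace_add hzl hwl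
  have h1 := hux _ hm
  rw [apply_lie_eq_zero_of_eq_trace_restrict hθ hzV hwV,
    ← LieModule.traceForm_apply_lie_apply, hzl ⟨u, hu⟩, map_smul, LinearMap.smul_apply,
    smul_eq_mul] at h1
  rw [← hθ _ hHV, ← hux _ (mem_wtSpace_zero_of_mem t H.2)]
  exact (hH ⟨u, hu⟩).trans ((mul_eq_zero.1 h1).resolve_right hzw)

theorem lie_mem_iSup_of_forall_lie_mem {ι : Type*} {W : ι → Submodule ℂ L} {x : L}
    (h : ∀ i, ∀ v ∈ W i, ⁅x, v⁆ ∈ ⨆ i, W i) : ∀ v ∈ ⨆ i, W i, ⁅x, v⁆ ∈ ⨆ i, W i := by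
  have : (⨆ i, W i) ≤ (⨆ i, W i).comap (LieAlgebra.ad ℂ L x) := iSup_le h
  exact this

theorem Multiset.exists_sum_eq_card_mul_add_intCast_mul {c d : ℂ} (s : Multiset ℂ)
    (h : ∀ a ∈ s, ∃ k : ℤ, c + k * d = a) : ∃ m : ℤ, s.sum = s.card * c + m * d := by
  induction s using Multiset.induction with
  | empty => exact ⟨0, by simp⟩
  | cons a s ih =>
    obtain ⟨m, hm⟩ := ih fun b hb => h b (Multiset.mem_cons_of_mem hb)
    obtain ⟨k, rfl⟩ := h a (Multiset.mem_cons_self a s)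
    refine ⟨k + m, ?_⟩
    rw [Multiset.sum_cons, Multiset.card_cons, hm]
    push_cast
    ring

theorem Multiset.exists_neg_sum_eq_mul {d : ℂ} (s : Multiset ℂ) (hs : s ≠ 0)
    (h : ∀ a ∈ s, ∃ r : ℝ, r < 0 ∧ r * d = a) : ∃ r : ℝ, r < 0 ∧ s.sum = r * d := by
  induction s using Multiset.induction with
  | empty => exact absurd rfl hs
  | cons a s ih =>
    obtain ⟨r, hr, rfl⟩ := h a (Multiset.mem_cons_self a s)
    rcases eq_or_ne s 0 with rfl | hs'
    · exact ⟨r, hr, by simp⟩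
    · obtain ⟨r', hr', hsum⟩ := ih hs' fun b hb => h b (Multiset.mem_cons_of_mem hb)
      refine ⟨r + r', add_neg hr hr', ?_⟩
      rw [Multiset.sum_cons, hsum]
      push_cast
      ring

theorem wtSpace_le_eigenspace_ad {t : LieSubalgebra ℂ L} (ρ : Module.Dual ℂ t) (s : t) :
    wtSpace t ρ ≤ (LieAlgebra.ad ℂ L s).eigenspace (ρ s) :=
  fun _ hx => Module.End.mem_eigenspace_iff.2 (hx s)

theorem finrank_iSup_pos_of_ne_bot {E ι : Type*} [AddCommGroup E] [Module ℂ E]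
    [FiniteDimensional ℂ E] {W : ι → Submodule ℂ E} {i : ι} (h : W i ≠ ⊥) :
    0 < Module.finrank ℂ (⨆ i, W i : Submodule ℂ E) :=
  Nat.pos_of_ne_zero fun h0 => h (eq_bot_iff.2
    ((le_iSup W i).trans (Submodule.finrank_eq_zero.1 h0).le))

theorem exists_real_apply_eq_mul [FiniteDimensional ℂ L]
    [LieAlgebra.IsKilling ℂ L] {t : LieSubalgebra ℂ L} [IsLieAbelian t]
    (htop : ⨆ ν : Module.Dual ℂ t, wtSpace t ν = ⊤)
    (hz : (t : Set L) =
      {x : L | (∀ s ∈ t, ⁅s, x⁆ = 0) ∧ ∀ y : L, (∀ s ∈ t, ⁅s, y⁆ = 0) → ⁅x, y⁆ = 0})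
    {l : Module.Dual ℂ t} {H : t} (hH : ∀ s : t, killingForm ℂ L s H = l s)
    {z w : L} (hzl : z ∈ wtSpace t l) (hwl : w ∈ wtSpace t (-l)) (hzw : killingForm ℂ L z w ≠ 0)
    {μ : Module.Dual ℂ t} (hμ : wtSpace t μ ≠ ⊥) : ∃ q : ℝ, μ H = q * l H := by
  let W : ℤ → Submodule ℂ L := fun k => wtSpace t (μ + k • l)
  have hstab : ∀ (j : ℤ) (x : L), x ∈ wtSpace t (j • l) → ∀ v ∈ ⨆ k, W k, ⁅x, v⁆ ∈ ⨆ k, W k := by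
    refine fun j x hx => lie_mem_iSup_of_forall_lie_mem fun k v hv =>
      Submodule.mem_iSup_of_mem (j + k) ?_
    have h := lie_mem_wtSpace_add hx hv
    rwa [add_left_comm, ← add_smul] at h
  have h0 : ∀ x ∈ wtSpace t 0, ∀ v ∈ ⨆ k, W k, ⁅x, v⁆ ∈ ⨆ k, W k :=
    fun x hx => hstab 0 x (by rwa [zero_smul])
  have hHV := h0 H (mem_wtSpace_zero_of_mem t H.2)
  have htr := trace_restrict_eq_zero_of_stable htop hz hH hzl hwl hzw h0
    (hstab 1 z (by rwa [one_smul])) (hstab (-1) w (by rwa [neg_one_smul])) hHV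
  obtain ⟨s, hcard, hs, hsum⟩ := exists_multiset_sum_eq_trace_restrict (LieAlgebra.ad ℂ L H) W
    (fun k => (μ + k • l) H) (fun k => wtSpace_le_eigenspace_ad _ H) hHV
  obtain ⟨m, hm⟩ := s.exists_sum_eq_card_mul_add_intCast_mul (c := μ H) (d := l H)
    (by simpa using hs)
  have hpos : 0 < s.card := hcard ▸ finrank_iSup_pos_of_ne_bot (i := 0) (by simpa [W] using hμ)
  rw [← hsum, htr] at hm
  have hne : (s.card : ℂ) ≠ 0 := Nat.cast_ne_zero.2 hpos.ne'
  refine ⟨-m / s.card, ?_⟩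
  push_cast
  field_simp
  linear_combination -hm

/-- If `z` of weight `l` kills `wtSpace t μ`, then `μ` and `l` are at an acute or right angle. -/
theorem nonneg_of_forall_lie_eq_zero [FiniteDimensional ℂ L]
    [LieAlgebra.IsKilling ℂ L] {t : LieSubalgebra ℂ L} [IsLieAbelian t]
    (htop : ⨆ ν : Module.Dual ℂ t, wtSpace t ν = ⊤)
    (hz : (t : Set L) =
      {x : L | (∀ s ∈ t, ⁅s, x⁆ = 0) ∧ ∀ y : L, (∀ s ∈ t, ⁅s, y⁆ = 0) → ⁅x, y⁆ = 0})
    {l : Module.Dual ℂ t} {H : t} (hH : ∀ s : t, killingForm ℂ L s H = l s) (hlH : l H ≠ 0)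
    {z w : L} (hzl : z ∈ wtSpace t l) (hwl : w ∈ wtSpace t (-l)) (hzw : killingForm ℂ L z w ≠ 0)
    {μ : Module.Dual ℂ t} (hμ : wtSpace t μ ≠ ⊥) (hzμ : ∀ x ∈ wtSpace t μ, ⁅z, x⁆ = 0)
    {q : ℝ} (hq : μ H = q * l H) : 0 ≤ q := by
  let W : ℕ → Submodule ℂ L := fun k => wtSpace t (μ - k • l)
  have h0 : ∀ x ∈ wtSpace t 0, ∀ v ∈ ⨆ k, W k, ⁅x, v⁆ ∈ ⨆ k, W k := by
    refine fun x hx => lie_mem_iSup_of_forall_lie_mem fun k v hv =>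
      Submodule.mem_iSup_of_mem k ?_
    simpa using lie_mem_wtSpace_add hx hv
  have hwV : ∀ v ∈ ⨆ k, W k, ⁅w, v⁆ ∈ ⨆ k, W k := by
    refine lie_mem_iSup_of_forall_lie_mem fun k v hv => Submodule.mem_iSup_of_mem (k + 1) ?_
    have h := lie_mem_wtSpace_add hwl hv
    rwa [show -l + (μ - k • l) = μ - (k + 1) • l by rw [succ_nsmul]; abel] at h
  have hzV : ∀ v ∈ ⨆ k, W k, ⁅z, v⁆ ∈ ⨆ k, W k := by
    refine lie_mem_iSup_of_forall_lie_mem fun k v hv => ?_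
    cases k with
    | zero =>
      rw [hzμ v (by simpa [W] using hv)]
      exact zero_mem _
    | succ k =>
      refine Submodule.mem_iSup_of_mem k ?_
      have h := lie_mem_wtSpace_add hzl hv
      rwa [show l + (μ - (k + 1) • l) = μ - k • l by rw [succ_nsmul]; abel] at h
  have hHV := h0 H (mem_wtSpace_zero_of_mem t H.2)
  have htr := trace_restrict_eq_zero_of_stable htop hz hH hzl hwl hzw h0 hzV hwV hHV
  obtain ⟨s, hcard, hs, hsum⟩ := exists_multiset_sum_eq_trace_restrict (LieAlgebra.ad ℂ L H) W
    (fun k => (μ - k • l) H) (fun k => wtSpace_le_eigenspace_ad _ H) hHV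
  have hpos : 0 < s.card := hcard ▸ finrank_iSup_pos_of_ne_bot (i := 0) (by simpa [W] using hμ)
  by_contra! hneg
  obtain ⟨r, hr, hrs⟩ := s.exists_neg_sum_eq_mul (d := l H) (Multiset.card_pos.1 hpos) (by
    intro a ha
    obtain ⟨k, rfl⟩ := hs a ha
    refine ⟨q - k, by linarith [k.cast_nonneg (α := ℝ)], ?_⟩
    simp only [LinearMap.sub_apply, LinearMap.smul_apply, hq, nsmul_eq_mul]
    push_cast
    ring)
  rw [← hsum, htr, eq_comm, mul_eq_zero] at hrs
  exact hrs.elim (fun h => hr.ne (Complex.ofReal_eq_zero.1 h)) hlH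

theorem apply_ne_zero_of_killingForm_eq [FiniteDimensional ℂ L]
    [LieAlgebra.IsKilling ℂ L] {t : LieSubalgebra ℂ L} [IsLieAbelian t]
    (htop : ⨆ ν : Module.Dual ℂ t, wtSpace t ν = ⊤)
    (hz : (t : Set L) =
      {x : L | (∀ s ∈ t, ⁅s, x⁆ = 0) ∧ ∀ y : L, (∀ s ∈ t, ⁅s, y⁆ = 0) → ⁅x, y⁆ = 0})
    {l : Module.Dual ℂ t} (hl : l ≠ 0) {H : t} (hH : ∀ s : t, killingForm ℂ L s H = l s)
    {z w : L} (hzl : z ∈ wtSpace t l) (hwl : w ∈ wtSpace t (-l))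
    (hzw : killingForm ℂ L z w ≠ 0) : l H ≠ 0 := by
  intro h0
  have hH0 : ∀ v : L, ⁅(H : L), v⁆ = 0 := by
    intro v
    have hv : v ∈ ⨆ ν : Module.Dual ℂ t, wtSpace t ν := htop ▸ Submodule.mem_top
    induction hv using Submodule.iSup_induction' with
    | zero => simp
    | add x y _ _ ihx ihy => rw [lie_add, ihx, ihy, add_zero]
    | mem ρ v hv =>
      by_cases hρ : wtSpace t ρ = ⊥
      · rw [hρ] at hv
        rw [(Submodule.mem_bot ℂ).1 hv, lie_zero]
      · obtain ⟨q, hq⟩ := exists_real_apply_eq_mul htop hz hH hzl hwl hzw hρ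
        rw [hv H, hq, h0, mul_zero, zero_smul]
  have had : LieAlgebra.ad ℂ L H = 0 := LinearMap.ext hH0
  refine hl (LinearMap.ext fun s => ?_)
  rw [← hH s, killingForm_apply_apply, had]
  simp

/-- let `L` be a complex semisimple Lie algebra and `t` a toral subalgebra
which is the center of its centralizer, with Kostant root system `R` (nonzero `t`-weights).
If `μ, ν, μ + ν ∈ R` then `[L_μ, L_ν] = L_{μ+ν}`. -/
theorem stmt16 [FiniteDimensional ℂ L] [LieAlgebra.IsSemisimple ℂ L]
    (t : LieSubalgebra ℂ L) [IsLieAbelian t]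
    (hsemi : ∀ x ∈ t, (LieAlgebra.ad ℂ L x).IsSemisimple)
    (hz : (t : Set L) =
      {x : L | (∀ s ∈ t, ⁅s, x⁆ = 0) ∧ ∀ y : L, (∀ s ∈ t, ⁅s, y⁆ = 0) → ⁅x, y⁆ = 0})
    (R : Set (Module.Dual ℂ t))
    (hR : R = {ν : Module.Dual ℂ t | ν ≠ 0 ∧ wtSpace t ν ≠ ⊥})
    (μ ν : Module.Dual ℂ t) (hμ : μ ∈ R) (hν : ν ∈ R) (hμν : μ + ν ∈ R) :
    Submodule.span ℂ {z : L | ∃ x ∈ wtSpace t μ, ∃ y ∈ wtSpace t ν, z = ⁅x, y⁆} =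
      wtSpace t (μ + ν) := by
  have htop := iSup_wtSpace_eq_top t hsemi
  subst hR
  apply le_antisymm
  · rw [Submodule.span_le]
    rintro _ ⟨x, hx, y, hy, rfl⟩
    exact lie_mem_wtSpace_add hx hy
  by_contra hnot
  obtain ⟨a, ha, haS⟩ := SetLike.not_le_iff_exists.1 hnot
  obtain ⟨f, hfa, hfS⟩ := Submodule.exists_le_ker_of_notMem haS
  obtain ⟨z, hzl, hzf⟩ := exists_mem_wtSpace_killingForm_eq htop (μ + ν) f
  have hzxy : ∀ x ∈ wtSpace t μ, ∀ y ∈ wtSpace t ν, killingForm ℂ L z ⁅x, y⁆ = 0 :=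
    fun x hx y hy => (hzf _ (lie_mem_wtSpace_add hx hy)).trans
      (hfS (Submodule.subset_span ⟨x, hx, y, hy, rfl⟩))
  have hzμ : ∀ x ∈ wtSpace t μ, ⁅z, x⁆ = 0 := by
    intro x hx
    have h := lie_mem_wtSpace_add hzl hx
    rw [show -(μ + ν) + μ = -ν by abel] at h
    refine eq_zero_of_forall_mem_wtSpace_neg htop h fun y hy => ?_
    rw [neg_neg] at hy
    rw [LieModule.traceForm_apply_lie_apply, hzxy x hx y hy]
  have hzν : ∀ y ∈ wtSpace t ν, ⁅z, y⁆ = 0 := by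
    intro y hy
    have h := lie_mem_wtSpace_add hzl hy
    rw [show -(μ + ν) + ν = -μ by abel] at h
    refine eq_zero_of_forall_mem_wtSpace_neg htop h fun x hx => ?_
    rw [neg_neg] at hx
    rw [LieModule.traceForm_apply_lie_apply, ← lie_skew, map_neg, hzxy x hx y hy, neg_zero]
  have hza : killingForm ℂ L z a ≠ 0 := hzf a ha ▸ hfa
  have ha' : a ∈ wtSpace t (-(-(μ + ν))) := by rwa [neg_neg]
  obtain ⟨H, hH⟩ := exists_mem_killingForm_eq_dual htop hz (-(μ + ν))
  have hlH := apply_ne_zero_of_killingForm_eq htop hz (neg_ne_zero.2 hμν.1) hH hzl ha' hza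
  obtain ⟨p, hp⟩ := exists_real_apply_eq_mul htop hz hH hzl ha' hza hμ.2
  obtain ⟨q, hq⟩ := exists_real_apply_eq_mul htop hz hH hzl ha' hza hν.2
  have hp0 := nonneg_of_forall_lie_eq_zero htop hz hH hlH hzl ha' hza hμ.2 hzμ hp
  have hq0 := nonneg_of_forall_lie_eq_zero htop hz hH hlH hzl ha' hza hν.2 hzν hq
  have hsum : ((p + q + 1 : ℝ) : ℂ) * (-(μ + ν)) H = 0 := by
    have hneg : (-(μ + ν)) H = -(μ H + ν H) := rfl
    push_cast
    linear_combination -hp - hq + hneg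
  have hpq := Complex.ofReal_eq_zero.1 ((mul_eq_zero.1 hsum).resolve_right hlH)
  linarith
end
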